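/- arXiv:1506.03881 — 8 statements merged into one kernel-verified Lean document; each statement's English description precedes it below -/
import Mathlib

section
/- For W a k-augmented spanning forest, the quotient group ℤ^{Wᶜ}/j_W(Z) is finite of order t(W)/t(X); in particular t(X) divides t(W), so t(W)/t(X) is a positive integer. -/
open Matrix

/-- The submatrix of `K` consisting of the columns in `W` (integer entries). -/
def colSubZ {p n : ℕ} (K : Matrix (Fin p) (Fin n) ℤ) (W : Finset (Fin n)) :
    Matrix (Fin p) {j : Fin n // j ∈ W} ℤ :=
  fun i j => K i j.1

/-- The submatrix of `K` consisting of the columns in `W`, with entries cast to `ℚ`. -/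
def colSubQ {p n : ℕ} (K : Matrix (Fin p) (Fin n) ℤ) (W : Finset (Fin n)) :
    Matrix (Fin p) {j : Fin n // j ∈ W} ℚ :=
  fun i j => (K i j.1 : ℚ)

/-- `t(W)`: the order of the torsion subgroup of `ker(L : ℤ^p → ℤ^q) / image(K_W : ℤ^W → ℤ^p)`. -/
noncomputable def torsOrd {p q n : ℕ} (L : Matrix (Fin q) (Fin p) ℤ)
    (K : Matrix (Fin p) (Fin n) ℤ) (W : Finset (Fin n)) : ℕ :=
  Nat.card (Submodule.torsion ℤ
    (↥(LinearMap.ker (Matrix.mulVecLin L)) ⧸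
      Submodule.comap (LinearMap.ker (Matrix.mulVecLin L)).subtype
        (LinearMap.range (Matrix.mulVecLin (colSubZ K W)))))

/-- A `k`-augmented spanning forest: a set `W` of columns with `|W| = rank_ℚ K + k`
whose rational kernel `ker(K_W : ℚ^W → ℚ^p)` has dimension `k`. -/
def IsAugSpanningForest {p n : ℕ} (K : Matrix (Fin p) (Fin n) ℤ) (k : ℕ)
    (W : Finset (Fin n)) : Prop :=
  W.card = (K.map (Int.cast : ℤ → ℚ)).rank + k ∧
    Module.finrank ℚ ↥(LinearMap.ker (Matrix.mulVecLin (colSubQ K W))) = k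

/-- A matrix applied to a vector supported on `W` only sees the columns in `W`. -/
theorem mulVec_eq_submatrix_mulVec {m n R : Type*} [Fintype n] [CommRing R]
    (A : Matrix m n R) (W : Finset n) (x : n → R) (hx : ∀ i ∉ W, x i = 0) :
    A *ᵥ x = A.submatrix id (Subtype.val : {j // j ∈ W} → n) *ᵥ (fun j => x j.1) := by
  ext i
  simp only [Matrix.mulVec, dotProduct, Matrix.submatrix_apply, id]
  rw [Finset.sum_coe_sort W (fun j => A i j * x j)]
  exact (Finset.sum_subset (Finset.subset_univ W) fun j _ hj => by simp [hx j hj]).symm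

/-- The image of the columns in `W` is the image of the vectors supported on `W`. -/
theorem mem_range_submatrix_iff {m n R : Type*} [Fintype n] [CommRing R]
    (A : Matrix m n R) (W : Finset n) (y : m → R) :
    y ∈ LinearMap.range (A.submatrix id (Subtype.val : {j // j ∈ W} → n)).mulVecLin ↔
      ∃ x : n → R, (∀ i ∉ W, x i = 0) ∧ A *ᵥ x = y := by
  classical
  constructor
  · rintro ⟨w, rfl⟩
    refine ⟨fun i => if h : i ∈ W then w ⟨i, h⟩ else 0, fun i hi => by simp [hi], ?_⟩
    rw [mulVec_eq_submatrix_mulVec A W _ fun i hi => by simp [hi]]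
    simp
  · rintro ⟨x, hx, rfl⟩
    exact ⟨fun j => x j.1, (mulVec_eq_submatrix_mulVec A W x hx).symm⟩

/-- The order of the torsion of `M ⧸ N` is the index of `N` in its saturation. -/
theorem card_torsion_quotient_eq_relIndex {M : Type*} [AddCommGroup M] (N : Submodule ℤ M) :
    Nat.card (Submodule.torsion ℤ (M ⧸ N)) =
      N.toAddSubgroup.relIndex
        ((Submodule.torsion ℤ (M ⧸ N)).comap N.mkQ).toAddSubgroup := by
  have hN : N.toAddSubgroup = (⊥ : AddSubgroup (M ⧸ N)).comap N.mkQ.toAddMonoidHom := by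
    ext x
    simp
  have hmap : (((Submodule.torsion ℤ (M ⧸ N)).comap N.mkQ).toAddSubgroup).map
      N.mkQ.toAddMonoidHom = (Submodule.torsion ℤ (M ⧸ N)).toAddSubgroup := by
    ext y
    constructor
    · rintro ⟨x, hx, rfl⟩
      exact hx
    · intro hy
      obtain ⟨x, rfl⟩ := N.mkQ_surjective y
      exact ⟨x, hy, rfl⟩
  conv_rhs => rw [hN]
  rw [AddSubgroup.relIndex_comap, hmap, AddSubgroup.relIndex_bot_left]
  rfl

theorem mem_comap_mkQ_torsion_iff {M : Type*} [AddCommGroup M] (N : Submodule ℤ M) (x : M) :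
    x ∈ (Submodule.torsion ℤ (M ⧸ N)).comap N.mkQ ↔ ∃ a : ℤ, a ≠ 0 ∧ a • x ∈ N := by
  rw [Submodule.mem_comap, Submodule.mem_torsion_iff]
  constructor
  · rintro ⟨a, ha⟩
    refine ⟨a, nonZeroDivisors.coe_ne_zero a, ?_⟩
    rw [← Submodule.Quotient.mk_eq_zero]
    exact ha
  · rintro ⟨a, ha, h⟩
    refine ⟨⟨a, mem_nonZeroDivisors_of_ne_zero ha⟩, ?_⟩
    exact (Submodule.Quotient.mk_eq_zero N).2 h

/-- Enlarging `N₁` to a submodule `N₂` of its saturation divides the order of the torsion of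
the quotient by the index. -/
theorem relIndex_mul_card_torsion_quotient {M : Type*} [AddCommGroup M] {N₁ N₂ : Submodule ℤ M}
    (hle : N₁ ≤ N₂) (htors : ∀ x ∈ N₂, ∃ a : ℤ, a ≠ 0 ∧ a • x ∈ N₁) :
    N₁.toAddSubgroup.relIndex N₂.toAddSubgroup * Nat.card (Submodule.torsion ℤ (M ⧸ N₂)) =
      Nat.card (Submodule.torsion ℤ (M ⧸ N₁)) := by
  have hsat : (Submodule.torsion ℤ (M ⧸ N₁)).comap N₁.mkQ =
      (Submodule.torsion ℤ (M ⧸ N₂)).comap N₂.mkQ := by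
    ext x
    rw [mem_comap_mkQ_torsion_iff, mem_comap_mkQ_torsion_iff]
    constructor
    · rintro ⟨a, ha, h⟩
      exact ⟨a, ha, hle h⟩
    · rintro ⟨a, ha, h⟩
      obtain ⟨b, hb, h'⟩ := htors _ h
      exact ⟨b * a, mul_ne_zero hb ha, by rwa [mul_smul]⟩
  rw [card_torsion_quotient_eq_relIndex, card_torsion_quotient_eq_relIndex, hsat]
  refine AddSubgroup.relIndex_mul_relIndex _ _ _ hle fun x hx => ?_
  exact (mem_comap_mkQ_torsion_iff N₂ x).2 ⟨1, one_ne_zero, by simpa using hx⟩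

/-- The relative index can be computed inside any submodule containing the larger one. -/
theorem relIndex_comap_subtype {M : Type*} [AddCommGroup M] (S N₁ N₂ : Submodule ℤ M)
    (hle : N₂ ≤ S) :
    (N₁.comap S.subtype).toAddSubgroup.relIndex (N₂.comap S.subtype).toAddSubgroup =
      N₁.toAddSubgroup.relIndex N₂.toAddSubgroup := by
  have hmap : ((N₂.comap S.subtype).toAddSubgroup).map S.subtype.toAddMonoidHom =
      N₂.toAddSubgroup := by
    ext y
    constructor
    · rintro ⟨z, hz, rfl⟩
      exact hz
    · intro hy
      exact ⟨⟨y, hle hy⟩, hy, rfl⟩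
  rw [← hmap]
  exact AddSubgroup.relIndex_comap N₁.toAddSubgroup S.subtype.toAddMonoidHom _

theorem range_colSubZ_univ {p n : ℕ} (K : Matrix (Fin p) (Fin n) ℤ) :
    LinearMap.range (colSubZ K Finset.univ).mulVecLin = LinearMap.range K.mulVecLin := by
  ext y
  refine (mem_range_submatrix_iff K Finset.univ y).trans ?_
  simp

theorem range_colSubZ_le {p n : ℕ} (K : Matrix (Fin p) (Fin n) ℤ) (W : Finset (Fin n)) :
    LinearMap.range (colSubZ K W).mulVecLin ≤ LinearMap.range K.mulVecLin := by
  intro y hy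
  obtain ⟨x, -, rfl⟩ := (mem_range_submatrix_iff K W y).1 hy
  exact ⟨x, rfl⟩

theorem IsAugSpanningForest.range_colSubQ {p n k : ℕ} {K : Matrix (Fin p) (Fin n) ℤ}
    {W : Finset (Fin n)} (hW : IsAugSpanningForest K k W) :
    LinearMap.range (colSubQ K W).mulVecLin =
      LinearMap.range (K.map (Int.cast : ℤ → ℚ)).mulVecLin := by
  apply Submodule.eq_of_le_of_finrank_eq
  · intro y hy
    obtain ⟨x, -, rfl⟩ := (mem_range_submatrix_iff (K.map (Int.cast : ℤ → ℚ)) W y).1 hy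
    exact ⟨x, rfl⟩
  · obtain ⟨hcard, hker⟩ := hW
    have h := LinearMap.finrank_range_add_finrank_ker (colSubQ K W).mulVecLin
    rw [hker, Module.finrank_pi, Fintype.card_coe, hcard] at h
    exact Nat.add_right_cancel h

/-- Every boundary has a nonzero multiple which is a boundary of a chain supported on `W`. -/
theorem IsAugSpanningForest.exists_smul_mem_range {p n k : ℕ} {K : Matrix (Fin p) (Fin n) ℤ}
    {W : Finset (Fin n)} (hW : IsAugSpanningForest K k W) (y : Fin p → ℤ)
    (hy : y ∈ LinearMap.range K.mulVecLin) :
    ∃ a : ℤ, a ≠ 0 ∧ a • y ∈ LinearMap.range (colSubZ K W).mulVecLin := by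
  obtain ⟨x, rfl⟩ := hy
  have hmem : (K.map (Int.cast : ℤ → ℚ)) *ᵥ (fun i => (x i : ℚ)) ∈
      LinearMap.range (colSubQ K W).mulVecLin := by
    rw [hW.range_colSubQ]
    exact ⟨_, rfl⟩
  obtain ⟨w, hw⟩ := hmem
  obtain ⟨a, ha⟩ := IsLocalization.exist_integer_multiples_of_finite (nonZeroDivisors ℤ) w
  choose v hv using ha
  refine ⟨a, nonZeroDivisors.coe_ne_zero a, v, ?_⟩
  ext i
  have hi := congrFun hw i
  have hv' : ∀ j, (v j : ℚ) = (a : ℤ) * w j := fun j => by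
    simpa [Algebra.smul_def] using hv j
  simp only [Matrix.mulVecLin_apply, Matrix.mulVec, dotProduct, colSubQ, Matrix.map_apply] at hi
  simp only [Matrix.mulVecLin_apply, Matrix.mulVec, dotProduct, colSubZ, Pi.smul_apply,
    smul_eq_mul]
  have : ((∑ j, K i j.1 * v j : ℤ) : ℚ) = (((a : ℤ) * ∑ j, K i j * x j : ℤ) : ℚ) := by
    push_cast
    rw [← hi, Finset.mul_sum]
    refine Finset.sum_congr rfl fun j _ => ?_
    rw [hv']
    ring
  exact_mod_cast this

/-- The restriction of a chain extends to a cycle iff its boundary is supported on `W`. -/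
theorem restrict_mem_range_iff {p n : ℕ} (K : Matrix (Fin p) (Fin n) ℤ) (W : Finset (Fin n))
    (x : Fin n → ℤ) :
    LinearMap.funLeft ℤ ℤ (Subtype.val : {i : Fin n // i ∉ W} → Fin n) x ∈ LinearMap.range
      ((LinearMap.funLeft ℤ ℤ (Subtype.val : {i : Fin n // i ∉ W} → Fin n)).comp
        (LinearMap.ker (Matrix.mulVecLin K)).subtype) ↔
    K.mulVecLin x ∈ LinearMap.range (colSubZ K W).mulVecLin := by
  refine Iff.trans ?_ (mem_range_submatrix_iff K W _).symm
  constructor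
  · rintro ⟨⟨z, hz⟩, h⟩
    refine ⟨x - z, fun i hi => ?_, ?_⟩
    · exact sub_eq_zero.2 (congrFun h ⟨i, hi⟩).symm
    · rw [Matrix.mulVec_sub, show K *ᵥ z = 0 from hz, sub_zero, Matrix.mulVecLin_apply]
  · rintro ⟨v, hv, h⟩
    refine ⟨⟨x - v, ?_⟩, ?_⟩
    · rw [LinearMap.mem_ker, map_sub, ← h, Matrix.mulVecLin_apply, sub_self]
    · ext i
      simp [LinearMap.funLeft_apply, hv i.1 i.2]

/-- The quotient by the restricted cycles has the order of the group of all boundaries modulo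
the boundaries of chains supported on `W`. -/
theorem card_quotient_restrict_eq_relIndex {p n : ℕ} (K : Matrix (Fin p) (Fin n) ℤ)
    (W : Finset (Fin n)) :
    Nat.card (({i : Fin n // i ∉ W} → ℤ) ⧸ LinearMap.range
      ((LinearMap.funLeft ℤ ℤ (Subtype.val : {i : Fin n // i ∉ W} → Fin n)).comp
        (LinearMap.ker (Matrix.mulVecLin K)).subtype)) =
      (LinearMap.range (colSubZ K W).mulVecLin).toAddSubgroup.relIndex
        (LinearMap.range K.mulVecLin).toAddSubgroup := by
  set r := LinearMap.funLeft ℤ ℤ (Subtype.val : {i : Fin n // i ∉ W} → Fin n)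
  set J := LinearMap.range (r.comp (LinearMap.ker (Matrix.mulVecLin K)).subtype)
  have hsurj : Function.Surjective r.toAddMonoidHom :=
    LinearMap.funLeft_surjective_of_injective ℤ ℤ _ Subtype.val_injective
  have hcomap : J.toAddSubgroup.comap r.toAddMonoidHom =
      (LinearMap.range (colSubZ K W).mulVecLin).toAddSubgroup.comap
        K.mulVecLin.toAddMonoidHom := by
    ext x
    exact restrict_mem_range_iff K W x
  have hrange : (LinearMap.range K.mulVecLin).toAddSubgroup =
      (⊤ : AddSubgroup (Fin n → ℤ)).map K.mulVecLin.toAddMonoidHom := by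
    ext y
    simp
  change J.toAddSubgroup.index = _
  rw [← AddSubgroup.index_comap_of_surjective J.toAddSubgroup hsurj, hcomap, hrange,
    ← AddSubgroup.relIndex_comap, AddSubgroup.relIndex_top_right]

theorem IsAugSpanningForest.finite_quotient_restrict {p n k : ℕ} {K : Matrix (Fin p) (Fin n) ℤ}
    {W : Finset (Fin n)} (hW : IsAugSpanningForest K k W) :
    Finite (({i : Fin n // i ∉ W} → ℤ) ⧸ LinearMap.range
      ((LinearMap.funLeft ℤ ℤ (Subtype.val : {i : Fin n // i ∉ W} → Fin n)).comp
        (LinearMap.ker (Matrix.mulVecLin K)).subtype)) := by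
  refine Module.finite_of_fg_torsion _ fun y => ?_
  obtain ⟨y, rfl⟩ := Submodule.Quotient.mk_surjective _ y
  obtain ⟨x, rfl⟩ :=
    LinearMap.funLeft_surjective_of_injective ℤ ℤ _ Subtype.val_injective y
  obtain ⟨a, ha, h⟩ := hW.exists_smul_mem_range (K.mulVecLin x) ⟨x, rfl⟩
  refine ⟨⟨a, mem_nonZeroDivisors_of_ne_zero ha⟩, ?_⟩
  rw [← map_smul, ← restrict_mem_range_iff, map_smul] at h
  exact (Submodule.Quotient.mk_eq_zero _).2 h

/-- For `W` a `k`-augmented spanning forest, the quotient `ℤ^{Wᶜ}/j_W(Z)` is finite of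
order `t(W)/t(X)`; in particular `t(X)` divides `t(W)`. -/
theorem quotient_by_restricted_cycles_finite_of_order_div
    {n p q : ℕ} (K : Matrix (Fin p) (Fin n) ℤ) (L : Matrix (Fin q) (Fin p) ℤ)
    (hLK : L * K = 0)
    (k : ℕ) (W : Finset (Fin n)) (hW : IsAugSpanningForest K k W) :
    Finite (({i : Fin n // i ∉ W} → ℤ) ⧸ LinearMap.range
      ((LinearMap.funLeft ℤ ℤ (Subtype.val : {i : Fin n // i ∉ W} → Fin n)).comp
        (LinearMap.ker (Matrix.mulVecLin K)).subtype)) ∧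
    Nat.card (({i : Fin n // i ∉ W} → ℤ) ⧸ LinearMap.range
      ((LinearMap.funLeft ℤ ℤ (Subtype.val : {i : Fin n // i ∉ W} → Fin n)).comp
        (LinearMap.ker (Matrix.mulVecLin K)).subtype)) * torsOrd L K Finset.univ =
      torsOrd L K W ∧
    torsOrd L K Finset.univ ∣ torsOrd L K W := by
  have hmul : Nat.card (({i : Fin n // i ∉ W} → ℤ) ⧸ LinearMap.range
      ((LinearMap.funLeft ℤ ℤ (Subtype.val : {i : Fin n // i ∉ W} → Fin n)).comp
        (LinearMap.ker (Matrix.mulVecLin K)).subtype)) * torsOrd L K Finset.univ =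
      torsOrd L K W := by
    have hle : LinearMap.range K.mulVecLin ≤ LinearMap.ker L.mulVecLin := by
      rintro _ ⟨x, rfl⟩
      simp [hLK]
    rw [card_quotient_restrict_eq_relIndex, ← relIndex_comap_subtype _ _ _ hle, torsOrd, torsOrd,
      range_colSubZ_univ]
    exact relIndex_mul_card_torsion_quotient
      (Submodule.comap_mono (range_colSubZ_le K W))
      fun x hx => hW.exists_smul_mem_range x.1 hx
  exact ⟨hW.finite_quotient_restrict, hmul, Dvd.intro_left _ hmul⟩
end

section
/- Let W be a k-reduced spanning coforest contained in a spanning coforest V. Then v(V) divides u(W,V)·v(W); equivalently, f(W)·v(W) = (u(W,V)/v(V))·v(W) is a positive integer. -/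
open Matrix

/-- A spanning coforest for `P`: a set `V` of indices with `|V| = rank_ℚ P` such that the
coordinate projection `proj_V` restricted to the rational span of the boundary lattice
`B = image P` is an isomorphism onto `ℚ^V`. -/
def IsSpanningCoforest {n m : ℕ} (P : Matrix (Fin n) (Fin m) ℤ) (V : Finset (Fin n)) : Prop :=
  V.card = (P.map (Int.cast : ℤ → ℚ)).rank ∧
    Function.Bijective
      ((LinearMap.funLeft ℚ ℚ (Subtype.val : {i : Fin n // i ∈ V} → Fin n)).comp
        (LinearMap.range (Matrix.mulVecLin (P.map (Int.cast : ℤ → ℚ)))).subtype)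

/-- A `k`-reduced spanning coforest: a set `W` with `|W| = rank_ℚ P − k` such that
`proj_W : B⊗ℚ → ℚ^W` is surjective. -/
def IsReducedSpanningCoforest {n m : ℕ} (P : Matrix (Fin n) (Fin m) ℤ) (k : ℕ)
    (W : Finset (Fin n)) : Prop :=
  W.card = (P.map (Int.cast : ℤ → ℚ)).rank - k ∧
    Function.Surjective
      ((LinearMap.funLeft ℚ ℚ (Subtype.val : {i : Fin n // i ∈ W} → Fin n)).comp
        (LinearMap.range (Matrix.mulVecLin (P.map (Int.cast : ℤ → ℚ)))).subtype)

/-- `v(V) = |ℤ^V / proj_V(B)|` where `B = image(P : ℤ^m → ℤ^n)`. -/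
noncomputable def vOrd {n m : ℕ} (P : Matrix (Fin n) (Fin m) ℤ) (V : Finset (Fin n)) : ℕ :=
  Nat.card (({i : Fin n // i ∈ V} → ℤ) ⧸ LinearMap.range
    ((LinearMap.funLeft ℤ ℤ (Subtype.val : {i : Fin n // i ∈ V} → Fin n)).comp
      (Matrix.mulVecLin P)))

/-- The lattice `B ∩ ℤ^{Wᶜ}`: boundaries vanishing on the coordinates in `W`. -/
def bdryLat {n m : ℕ} (P : Matrix (Fin n) (Fin m) ℤ) (W : Finset (Fin n)) :
    Submodule ℤ (Fin n → ℤ) :=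
  LinearMap.range (Matrix.mulVecLin P) ⊓
    LinearMap.ker (LinearMap.funLeft ℤ ℤ (Subtype.val : {i : Fin n // i ∈ W} → Fin n))

/-- `u(W,V) = |ℤ^I / proj_I(B ∩ ℤ^{Wᶜ})|` where `I = V \ W`. -/
noncomputable def uOrd {n m : ℕ} (P : Matrix (Fin n) (Fin m) ℤ) (W V : Finset (Fin n)) : ℕ :=
  Nat.card (({i : Fin n // i ∈ V \ W} → ℤ) ⧸ LinearMap.range
    ((LinearMap.funLeft ℤ ℤ (Subtype.val : {i : Fin n // i ∈ V \ W} → Fin n)).comp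
      (bdryLat P W).subtype))

/-- Multiplicativity of the index along a short exact sequence `A → B → C → 0`. -/
theorem AddSubgroup.index_comap_mul_index_map_of_exact {A B C : Type*}
    [AddCommGroup A] [AddCommGroup B] [AddCommGroup C] (g : A →+ B) (f : B →+ C)
    (hf : Function.Surjective f) (hgf : g.range = f.ker) (L : AddSubgroup B) :
    (L.comap g).index * (L.map f).index = L.index := by
  rw [AddSubgroup.index_comap, AddSubgroup.index_map, AddMonoidHom.range_eq_top.2 hf,
    AddSubgroup.index_top, mul_one, hgf, ← AddSubgroup.relIndex_sup_right, sup_comm f.ker L,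
    AddSubgroup.relIndex_mul_index le_sup_left]

/-- The short exact sequence `ℤ^{V \ W} → ℤ^V → ℤ^W` for `W ⊆ V` splits `v(V)` as a product. -/
theorem uOrd_mul_vOrd_eq_vOrd {n m : ℕ} (P : Matrix (Fin n) (Fin m) ℤ) {W V : Finset (Fin n)}
    (hWV : W ⊆ V) : uOrd P W V * vOrd P W = vOrd P V := by
  let s : {i : Fin n // i ∈ W} → {i : Fin n // i ∈ V} := fun i => ⟨i, hWV i.2⟩
  let t : {i : Fin n // i ∈ V \ W} → {i : Fin n // i ∈ V} :=
    fun i => ⟨i, (Finset.mem_sdiff.1 i.2).1⟩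
  have hs : Function.Injective s := fun a b h => Subtype.ext (congrArg (fun x => x.1) h)
  have ht : Function.Injective t := fun a b h => Subtype.ext (congrArg (fun x => x.1) h)
  have hst (i : {i : Fin n // i ∈ W}) : ¬ ∃ j, t j = s i := by
    rintro ⟨j, hj⟩
    have h : (j : Fin n) = i := congrArg (fun x => x.1) hj
    exact (Finset.mem_sdiff.1 j.2).2 (h ▸ i.2)
  let f := LinearMap.funLeft ℤ ℤ s
  let g := Function.ExtendByZero.linearMap ℤ t
  have hg (x : {i : Fin n // i ∈ V \ W} → ℤ) (j) : g x (t j) = x j :=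
    ht.extend_apply x (0 : {i : Fin n // i ∈ V} → ℤ) j
  have hg0 (x : {i : Fin n // i ∈ V \ W} → ℤ) (i) : g x (s i) = 0 :=
    Function.extend_apply' x (0 : {i : Fin n // i ∈ V} → ℤ) _ (hst i)
  have eq_of_restrict {x y : {i : Fin n // i ∈ V} → ℤ} (h₁ : ∀ i, x (s i) = y (s i))
      (h₂ : ∀ j, x (t j) = y (t j)) : x = y := by
    ext ⟨i, hi⟩
    by_cases h : i ∈ W
    · exact h₁ ⟨i, h⟩
    · exact h₂ ⟨i, Finset.mem_sdiff.2 ⟨hi, h⟩⟩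
  have hf : Function.Surjective f := LinearMap.funLeft_surjective_of_injective ℤ ℤ s hs
  have hgf : g.toAddMonoidHom.range = f.toAddMonoidHom.ker := by
    ext y
    constructor
    · rintro ⟨x, rfl⟩
      exact funext (hg0 x)
    · intro hy
      let x : {i : Fin n // i ∈ V \ W} → ℤ := fun j => y (t j)
      exact ⟨x, eq_of_restrict (fun i => (hg0 x i).trans (congrFun hy i).symm) (hg x)⟩
  let L := LinearMap.range ((LinearMap.funLeft ℤ ℤ
    (Subtype.val : {i : Fin n // i ∈ V} → Fin n)).comp (Matrix.mulVecLin P))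
  have hmap : LinearMap.range ((LinearMap.funLeft ℤ ℤ
      (Subtype.val : {i : Fin n // i ∈ W} → Fin n)).comp (Matrix.mulVecLin P)) = L.map f :=
    LinearMap.range_comp ((LinearMap.funLeft ℤ ℤ Subtype.val).comp (Matrix.mulVecLin P)) f
  have hcomap : LinearMap.range ((LinearMap.funLeft ℤ ℤ
      (Subtype.val : {i : Fin n // i ∈ V \ W} → Fin n)).comp (bdryLat P W).subtype) =
      L.comap g := by
    ext x
    constructor
    · rintro ⟨⟨_, ⟨z, rfl⟩, hz⟩, rfl⟩
      exact ⟨z, eq_of_restrict (fun i => (congrFun hz i).trans (hg0 _ i).symm)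
        fun j => (hg (fun j => P.mulVecLin z j) j).symm⟩
    · rintro ⟨z, hz⟩
      exact ⟨⟨P.mulVecLin z, ⟨z, rfl⟩, funext fun i => (congrFun hz (s i)).trans (hg0 x i)⟩,
        funext fun j => (congrFun hz (t j)).trans (hg x j)⟩
  rw [uOrd, vOrd, hmap, hcomap]
  exact AddSubgroup.index_comap_mul_index_map_of_exact g.toAddMonoidHom f.toAddMonoidHom hf hgf
    L.toAddSubgroup

/-- For `W` a `k`-reduced spanning coforest contained in a spanning coforest `V`,
`v(V)` divides `u(W,V)·v(W)`. -/
theorem vOrd_dvd_uOrd_mul_vOrd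
    {n m : ℕ} (P : Matrix (Fin n) (Fin m) ℤ)
    (k : ℕ) (W V : Finset (Fin n))
    (hW : IsReducedSpanningCoforest P k W) (hV : IsSpanningCoforest P V)
    (hWV : W ⊆ V) :
    vOrd P V ∣ uOrd P W V * vOrd P W := by
  rw [uOrd_mul_vOrd_eq_vOrd P hWV]
end

section
/- For 0 < k ≤ rank_ℚ K, the k-th elementary symmetric function of the eigenvalues of the combinatorial Laplacian K·Kᵀ (the sum of all principal k×k minors of K·Kᵀ) equals the sum, over all pairs (J, I) where J is a forest of size k and I is a spanning coforest of X_J, of the square of the order of the finite cokernel ℤ^I / K_{I,J}(ℤ^J) of the nonsingular square integer matrix K_{I,J}. -/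
open Matrix

/-- The submatrix `K_{I,J}` with rows in `I` and columns in `J` (integer entries). -/
def subMatZ {p n : ℕ} (K : Matrix (Fin p) (Fin n) ℤ) (I : Finset (Fin p))
    (J : Finset (Fin n)) : Matrix {i : Fin p // i ∈ I} {j : Fin n // j ∈ J} ℤ :=
  fun i j => K i.1 j.1

/-- The submatrix `K_{I,J}` with entries cast to `ℚ`. -/
def subMatQ {p n : ℕ} (K : Matrix (Fin p) (Fin n) ℤ) (I : Finset (Fin p))
    (J : Finset (Fin n)) : Matrix {i : Fin p // i ∈ I} {j : Fin n // j ∈ J} ℚ :=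
  fun i j => (K i.1 j.1 : ℚ)

/-- A forest of size `k`: a set `J` of columns with `|J| = k` such that
`K_J : ℚ^J → ℚ^p` is injective. -/
def IsForestOfSize {p n : ℕ} (K : Matrix (Fin p) (Fin n) ℤ) (k : ℕ)
    (J : Finset (Fin n)) : Prop :=
  J.card = k ∧
    Function.Injective (Matrix.mulVecLin (subMatQ K Finset.univ J ∘ fun i : Fin p => ⟨i, Finset.mem_univ i⟩))

/-- `I` is a spanning coforest of `X_J`: `|I| = |J|` and the square matrix
`K_{I,J} : ℚ^J → ℚ^I` is an isomorphism. -/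
def IsSpanningCoforestOf {p n : ℕ} (K : Matrix (Fin p) (Fin n) ℤ)
    (J : Finset (Fin n)) (I : Finset (Fin p)) : Prop :=
  I.card = J.card ∧ Function.Bijective (Matrix.mulVecLin (subMatQ K I J))

/-- The order of the cokernel `ℤ^I / K_{I,J}(ℤ^J)`. -/
noncomputable def cokOrd {p n : ℕ} (K : Matrix (Fin p) (Fin n) ℤ) (I : Finset (Fin p))
    (J : Finset (Fin n)) : ℕ :=
  Nat.card (({i : Fin p // i ∈ I} → ℤ) ⧸ LinearMap.range (Matrix.mulVecLin (subMatZ K I J)))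

namespace Matrix

variable {m n R : Type*} [Fintype m] [DecidableEq m] [Fintype n] [CommRing R]

/-- The determinant of a product expanded along all ways to select, for each row of the left
factor, a row of the right factor. -/
theorem det_mul_eq_sum_det_submatrix (A : Matrix m n R) (B : Matrix n m R) :
    (A * B).det = ∑ f : m → n, (∏ i, A i (f i)) * (B.submatrix f id).det := by
  classical
  have h : A * B = fun i => ∑ j, A i j • B j := by
    ext i l
    simp [mul_apply]
  have hsum := (detRowAlternating (n := m) (R := R)).toMultilinearMap.map_sum
    (fun i j => A i j • B j)
  rw [h]
  refine hsum.trans (Finset.sum_congr rfl fun f _ => ?_)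
  exact (detRowAlternating (n := m) (R := R)).toMultilinearMap.map_smul_univ
    (fun i => A i (f i)) (fun i => B (f i))

/-- The contribution to the expansion of `(A * B).det` of the selections of rows enumerating a
fixed set `J` of size `Fintype.card m`. -/
theorem sum_prod_mul_det_submatrix_of_image_eq [DecidableEq n] (A : Matrix m n R)
    (B : Matrix n m R) {J : Finset n} (e : m ≃ J) :
    ∑ f : m → n with Finset.univ.image f = J, (∏ i, A i (f i)) * (B.submatrix f id).det =
      (A.submatrix id (fun i => (e i : n))).det * (B.submatrix (fun i => (e i : n)) id).det := by
  symm
  rw [← det_transpose (A.submatrix _ _), det_apply', Finset.sum_mul]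
  refine Finset.sum_bij (fun σ _ i => (e (σ i) : n)) ?_ ?_ ?_ ?_
  · intro σ _
    rw [Finset.mem_filter_univ]
    ext j
    simp only [Finset.mem_image, Finset.mem_univ, true_and]
    constructor
    · rintro ⟨i, rfl⟩
      exact (e (σ i)).2
    · intro hj
      exact ⟨σ.symm (e.symm ⟨j, hj⟩), by simp⟩
  · intro σ _ τ _ h
    ext i
    exact e.injective (Subtype.ext (congrFun h i))
  · intro f hf
    rw [Finset.mem_filter_univ] at hf
    have hmem : ∀ i, f i ∈ J := fun i => hf ▸ Finset.mem_image_of_mem f (Finset.mem_univ i)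
    let g : m → m := fun i => e.symm ⟨f i, hmem i⟩
    have hg : Function.Surjective g := by
      intro i
      obtain ⟨l, -, hl⟩ := Finset.mem_image.1 (hf.symm ▸ (e i).2 : (e i : n) ∈ Finset.univ.image f)
      exact ⟨l, by simp [g, hl]⟩
    refine ⟨Equiv.ofBijective g (Finite.surjective_iff_bijective.1 hg), Finset.mem_univ _, ?_⟩
    ext i
    simp [g]
  · intro σ _
    have h := det_permute σ (B.submatrix (fun i => (e i : n)) id)
    rw [submatrix_submatrix] at h
    change _ = _ * (B.submatrix ((fun i => (e i : n)) ∘ σ) (id ∘ id)).det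
    rw [h]
    simp only [transpose_apply, submatrix_apply, id]
    ring

/-- The **Cauchy–Binet formula**. -/
theorem det_mul_eq_sum_det_mul_det [DecidableEq n] (A : Matrix m n R) (B : Matrix n m R)
    (e : ∀ J : {J : Finset n // J.card = Fintype.card m}, m ≃ J.1) :
    (A * B).det = ∑ J, (A.submatrix id (fun i => (e J i : n))).det *
      (B.submatrix (fun i => (e J i : n)) id).det := by
  rw [det_mul_eq_sum_det_submatrix, ← Finset.sum_fiberwise _ (fun f => Finset.univ.image f)]
  simp_rw [← sum_prod_mul_det_submatrix_of_image_eq A B (e _)]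
  rw [← Finset.sum_subtype (Finset.univ.filter fun J => J.card = Fintype.card m)
    (p := fun J : Finset n => J.card = Fintype.card m) (by simp)
    (fun J => ∑ f : m → n with Finset.univ.image f = J,
      (∏ i, A i (f i)) * (B.submatrix f id).det)]
  refine (Finset.sum_subset (Finset.filter_subset _ _) fun J _ hJ => ?_).symm
  refine Finset.sum_eq_zero fun f hf => ?_
  rw [Finset.mem_filter_univ] at hJ hf
  have hinj : ¬ Function.Injective f := fun h => hJ (by
    rw [← hf, Finset.card_image_of_injective _ h, Finset.card_univ])
  obtain ⟨i, j, hij, hne⟩ := Function.not_injective_iff.1 hinj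
  rw [det_zero_of_row_eq hne (by ext l; simp [hij]), mul_zero]

end Matrix

/-- The cokernel of a nonsingular square integer matrix has order the absolute value of the
determinant. -/
theorem Matrix.card_quotient_range_mulVecLin {ι : Type*} [Fintype ι] [DecidableEq ι]
    {A : Matrix ι ι ℤ} (hA : A.det ≠ 0) :
    Nat.card ((ι → ℤ) ⧸ LinearMap.range A.mulVecLin) = A.det.natAbs := by
  have hinj : Function.Injective A.mulVecLin :=
    mulVec_injective_of_det_mem_nonZeroDivisors (mem_nonZeroDivisors_of_ne_zero hA)
  rw [← Submodule.natAbs_det_equiv _ (LinearEquiv.ofInjective A.mulVecLin hinj),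
    ← LinearMap.det_toLin' A]
  rfl

section Minors

variable {p n : ℕ} (K : Matrix (Fin p) (Fin n) ℤ) {I : Finset (Fin p)} {J : Finset (Fin n)}

theorem bijective_subMatQ_iff (e : {i // i ∈ I} ≃ {j // j ∈ J}) :
    Function.Bijective (subMatQ K I J).mulVecLin ↔ ((subMatZ K I J).submatrix id e).det ≠ 0 := by
  have hcomp : ⇑((subMatQ K I J).submatrix id e).mulVecLin =
      (subMatQ K I J).mulVecLin ∘ (LinearEquiv.funCongrLeft ℚ ℚ e.symm) := by
    rw [mulVecLin_submatrix]
    rfl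
  have hdet : ((subMatQ K I J).submatrix id e).det = (((subMatZ K I J).submatrix id e).det : ℚ) :=
    (Int.cast_det _).symm
  rw [← Function.Bijective.of_comp_iff _ (LinearEquiv.funCongrLeft ℚ ℚ e.symm).bijective, ← hcomp,
    ← Int.cast_ne_zero (α := ℚ), ← hdet, ← isUnit_iff_ne_zero, ← isUnit_iff_isUnit_det]
  exact ⟨fun h => mulVec_injective_iff_isUnit.1 h.1,
    fun h => ⟨mulVec_injective_iff_isUnit.2 h, mulVec_surjective_iff_isUnit.2 h⟩⟩

theorem cokOrd_eq_natAbs_det (e : {i // i ∈ I} ≃ {j // j ∈ J})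
    (h : ((subMatZ K I J).submatrix id e).det ≠ 0) :
    cokOrd K I J = ((subMatZ K I J).submatrix id e).det.natAbs := by
  have hcomp : ((subMatZ K I J).submatrix id e).mulVecLin =
      (subMatZ K I J).mulVecLin ∘ₗ (LinearEquiv.funCongrLeft ℤ ℤ e.symm).toLinearMap := by
    rw [mulVecLin_submatrix]
    rfl
  rw [← card_quotient_range_mulVecLin h, cokOrd, hcomp,
    LinearMap.range_comp_of_range_eq_top _ (LinearEquiv.range _)]

open Classical in
theorem det_sq_eq_ite_cokOrd_sq (e : {i // i ∈ I} ≃ {j // j ∈ J}) :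
    ((subMatZ K I J).submatrix id e).det ^ 2 =
      if IsSpanningCoforestOf K J I then (cokOrd K I J : ℤ) ^ 2 else 0 := by
  have hcard : I.card = J.card := by simpa using Fintype.card_congr e
  have hiff : IsSpanningCoforestOf K J I ↔ ((subMatZ K I J).submatrix id e).det ≠ 0 := by
    rw [← bijective_subMatQ_iff, IsSpanningCoforestOf, and_iff_right hcard]
  rw [hiff]
  split_ifs with h
  · rw [cokOrd_eq_natAbs_det K e h, Int.natAbs_sq]
  · simpa using h

variable {K} in
theorem IsSpanningCoforestOf.isForestOfSize (h : IsSpanningCoforestOf K J I) :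
    IsForestOfSize K J.card J := by
  refine ⟨rfl, fun x y hxy => h.2.1 ?_⟩
  ext i
  exact congrFun hxy i.1

open Classical in
theorem det_principal_minor_eq_sum_cokOrd_sq (I : Finset (Fin p)) :
    ((K * Kᵀ).submatrix ((↑) : {i : Fin p // i ∈ I} → Fin p)
      ((↑) : {i : Fin p // i ∈ I} → Fin p)).det =
      ∑ J ∈ Finset.powersetCard I.card Finset.univ,
        if IsSpanningCoforestOf K J I then (cokOrd K I J : ℤ) ^ 2 else 0 := by
  have e : ∀ J : {J : Finset (Fin n) // J.card = Fintype.card {i // i ∈ I}},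
      {i // i ∈ I} ≃ {j // j ∈ J.1} := fun J =>
    Fintype.equivOfCardEq (by simpa using J.2.symm)
  rw [submatrix_mul _ _ _ id _ Function.bijective_id, det_mul_eq_sum_det_mul_det _ _ e,
    Finset.sum_subtype (p := fun J : Finset (Fin n) => J.card = Fintype.card {i // i ∈ I}) _ (by simp)]
  refine Finset.sum_congr rfl fun J _ => ?_
  rw [← det_sq_eq_ite_cokOrd_sq K (e J), sq]
  congr 1
  exact det_transpose ((subMatZ K I J).submatrix id (e J))

end Minors

open Classical in
/-- Kirchhoff-type theorem: the `k`-th elementary symmetric function of the eigenvalues of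
the combinatorial Laplacian `K·Kᵀ` equals the sum over pairs `(J, I)` of a forest `J` of
size `k` and a spanning coforest `I` of `X_J` of the square of `|ℤ^I / K_{I,J}(ℤ^J)|`. -/
theorem laplacian_esymm_eq_sum_forest_coforest_pairs
    {p n : ℕ} (K : Matrix (Fin p) (Fin n) ℤ)
    (k : ℕ) (hk0 : 0 < k) (hk : k ≤ (K.map (Int.cast : ℤ → ℚ)).rank) :
    (∑ s ∈ Finset.powersetCard k (Finset.univ : Finset (Fin p)),
        ((K * Kᵀ).submatrix ((↑) : {i : Fin p // i ∈ s} → Fin p)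
          ((↑) : {i : Fin p // i ∈ s} → Fin p)).det) =
      ∑ J ∈ Finset.univ.filter (fun J => IsForestOfSize K k J),
        ∑ I ∈ Finset.univ.filter (fun I => IsSpanningCoforestOf K J I),
          ((cokOrd K I J : ℤ))^2 := by
  calc
    _ = ∑ I ∈ Finset.powersetCard k Finset.univ, ∑ J ∈ Finset.powersetCard k Finset.univ,
        if IsSpanningCoforestOf K J I then (cokOrd K I J : ℤ) ^ 2 else 0 := by
      refine Finset.sum_congr rfl fun I hI => ?_
      rw [← (Finset.mem_powersetCard.1 hI).2, ← det_principal_minor_eq_sum_cokOrd_sq]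
    _ = ∑ J ∈ Finset.powersetCard k Finset.univ, ∑ I with IsSpanningCoforestOf K J I,
        (cokOrd K I J : ℤ) ^ 2 := by
      rw [Finset.sum_comm]
      refine Finset.sum_congr rfl fun J hJ => ?_
      rw [← Finset.sum_filter]
      refine Finset.sum_congr ?_ fun _ _ => rfl
      ext I
      have hcard := (Finset.mem_powersetCard.1 hJ).2
      simp only [Finset.mem_filter, Finset.mem_powersetCard_univ, Finset.mem_univ, true_and,
        and_iff_right_iff_imp]
      exact fun h => h.1.trans hcard
    _ = _ := by
      symm
      refine Finset.sum_subset (fun J hJ => ?_) fun J hJ hforest => ?_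
      · exact Finset.mem_powersetCard_univ.2 (Finset.mem_filter.1 hJ).2.1
      · refine Finset.sum_eq_zero fun I hI => absurd ?_ hforest
        have h := (Finset.mem_filter.1 hI).2.isForestOfSize
        rw [Finset.mem_powersetCard_univ.1 hJ] at h
        simpa using h
end

section
/- Let V₀ be a spanning forest. For each column index σ not in V₀ there is a unique vector z(σ) ∈ ker(K : ℚ^n → ℚ^p) supported on V₀ ∪ {σ} whose σ-coordinate equals 1, and {z(σ) : σ ∉ V₀} is a ℚ-basis of ker(K : ℚ^n → ℚ^p). Let G be the rational square matrix indexed by the complement of V₀ with entries G_{σ,σ'} = ⟨z(σ), z(σ')⟩ (standard inner product on ℚ^n), the cycle mesh matrix in the geometric basis determined by V₀. Then for every 0 ≤ k ≤ z, the k-th elementary symmetric function of the eigenvalues of G (the sum of all principal k×k minors of G) equals Σ over subsets U of the complement of V₀ with |U| = k of Σ over spanning forests V with V ⊆ V₀ ∪ U of (t(V)/t(V₀))². -/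
open Matrix

/-- A spanning forest: a set `V` of columns with `|V| = rank_ℚ K` such that `K_V` is
injective over `ℚ`. -/
def IsSpanningForest {p n : ℕ} (K : Matrix (Fin p) (Fin n) ℤ) (V : Finset (Fin n)) : Prop :=
  V.card = (K.map (Int.cast : ℤ → ℚ)).rank ∧
    Function.Injective (Matrix.mulVecLin (colSubQ K V))

theorem Matrix.det_mul_eq_sum_minors {m n R : Type*} [Fintype m] [DecidableEq m] [Fintype n]
    [DecidableEq n] [CommRing R] (A : Matrix m n R) (B : Matrix n m R)
    (e : ∀ V : {V : Finset n // V.card = Fintype.card m}, m ≃ V.1) :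
    (A * B).det = ∑ V, (A.submatrix id fun i => (e V i : n)).det *
      (B.submatrix (fun i => (e V i : n)) id).det := by
  have expand : (A * B).det = ∑ f : m → n, (A.submatrix id f).det * ∏ i, B (f i) i := by
    simp only [det_apply', mul_apply, Finset.prod_univ_sum, Finset.mul_sum,
      Fintype.piFinset_univ, Finset.sum_mul, submatrix_apply, id]
    rw [Finset.sum_comm]
    refine Finset.sum_congr rfl fun f _ => Finset.sum_congr rfl fun σ _ => ?_
    rw [Finset.prod_mul_distrib, mul_assoc]
  have restrict : ∑ f : m → n, (A.submatrix id f).det * ∏ i, B (f i) i =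
      ∑ f : {f : m → n // Function.Injective f},
        (A.submatrix id f.1).det * ∏ i, B (f.1 i) i := by
    rw [← Finset.sum_subtype (Finset.univ.filter fun f : m → n => Function.Injective f) (by simp)
      fun f => (A.submatrix id f).det * ∏ i, B (f i) i]
    symm
    refine Finset.sum_subset (Finset.subset_univ _) fun f _ hf => ?_
    obtain ⟨i, j, hij, hne⟩ : ∃ i j, f i = f j ∧ i ≠ j := by
      rwa [Finset.mem_filter_univ, Function.not_injective_iff] at hf
    rw [det_zero_of_column_eq hne (by simp [hij]), zero_mul]
  have permute : ∀ V, (A.submatrix id fun i => (e V i : n)).det *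
      (B.submatrix (fun i => (e V i : n)) id).det =
      ∑ τ : Equiv.Perm m, (A.submatrix id fun i => (e V (τ i) : n)).det *
        ∏ i, B (e V (τ i)) i := by
    intro V
    rw [det_apply' (B.submatrix _ _), Finset.mul_sum]
    refine Finset.sum_congr rfl fun τ _ => ?_
    have := det_permute' τ (A.submatrix id fun i => (e V i : n))
    rw [submatrix_submatrix] at this
    change _ = det (A.submatrix (id ∘ id) ((fun i => (e V i : n)) ∘ τ)) * _
    rw [this]
    simp only [submatrix_apply, id]
    ring
  simp_rw [expand, restrict, permute]
  rw [← Fintype.sum_sigma' (fun V (τ : Equiv.Perm m) =>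
    (A.submatrix id fun i => (e V (τ i) : n)).det * ∏ i, B (e V (τ i)) i)]
  symm
  refine Fintype.sum_bijective (fun x : (_ : {V : Finset n // V.card = Fintype.card m}) ×
      Equiv.Perm m => (⟨fun i => (e x.1 (x.2 i) : n),
        Subtype.val_injective.comp ((e x.1).injective.comp x.2.injective)⟩ :
      {f : m → n // Function.Injective f})) ⟨?_, ?_⟩ _ _ (fun _ => rfl)
  · rintro ⟨V, τ⟩ ⟨W, ρ⟩ h
    have h' : ∀ i, (e V (τ i) : n) = e W (ρ i) := fun i => congrFun (congrArg Subtype.val h) i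
    have mem : ∀ (V : {V : Finset n // V.card = Fintype.card m}) (τ : Equiv.Perm m) (x : n),
        x ∈ V.1 ↔ ∃ i, (e V (τ i) : n) = x := by
      intro V τ x
      refine ⟨fun hx => ⟨τ.symm ((e V).symm ⟨x, hx⟩), by simp⟩, ?_⟩
      rintro ⟨i, rfl⟩
      exact (e V (τ i)).2
    obtain rfl : V = W := by
      ext x
      rw [mem V τ, mem W ρ]
      simp [h']
    obtain rfl : τ = ρ := by
      ext i
      exact (e V).injective (Subtype.ext (h' i))
    rfl
  · rintro ⟨f, hf⟩
    let V : {V : Finset n // V.card = Fintype.card m} :=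
      ⟨Finset.univ.image f, by rw [Finset.card_image_of_injective _ hf, Finset.card_univ]⟩
    let g : m → V.1 := fun i => ⟨f i, by simp [V]⟩
    have hg : Function.Bijective g := by
      refine ⟨fun i j h => hf (congrArg Subtype.val h), ?_⟩
      rintro ⟨x, hx⟩
      obtain ⟨i, -, rfl⟩ := Finset.mem_image.1 hx
      exact ⟨i, rfl⟩
    refine ⟨⟨V, (Equiv.ofBijective g hg).trans (e V).symm⟩, ?_⟩
    ext i
    simp [g]

open Submodule in
theorem card_torsion_quotient {M : Type*} [AddCommGroup M] (N : Submodule ℤ M) :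
    Nat.card (torsion ℤ (M ⧸ N)) =
      Nat.card (↥((torsion ℤ (M ⧸ N)).comap N.mkQ) ⧸
        N.submoduleOf ((torsion ℤ (M ⧸ N)).comap N.mkQ)) := by
  set S := (torsion ℤ (M ⧸ N)).comap N.mkQ
  let f : S →ₗ[ℤ] torsion ℤ (M ⧸ N) := N.mkQ.restrict fun x hx => hx
  have hf : Function.Surjective f := by
    rintro ⟨y, hy⟩
    obtain ⟨x, rfl⟩ := N.mkQ_surjective y
    exact ⟨⟨x, hy⟩, rfl⟩
  have hker : LinearMap.ker f = N.submoduleOf S := by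
    ext x
    simp [f, Submodule.submoduleOf, Subtype.ext_iff]
  rw [← hker]
  exact (Nat.card_congr (f.quotKerEquivOfSurjective hf).toEquiv).symm

theorem mem_comap_torsion {M : Type*} [AddCommGroup M] (N : Submodule ℤ M) (x : M) :
    x ∈ (Submodule.torsion ℤ (M ⧸ N)).comap N.mkQ ↔ ∃ c : ℤ, c ≠ 0 ∧ c • x ∈ N := by
  rw [Submodule.mem_comap, Submodule.mem_torsion_iff]
  constructor
  · rintro ⟨a, ha⟩
    refine ⟨a, nonZeroDivisors.coe_ne_zero a, ?_⟩
    rw [← Submodule.Quotient.mk_eq_zero]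
    exact ha
  · rintro ⟨c, hc, h⟩
    refine ⟨⟨c, mem_nonZeroDivisors_of_ne_zero hc⟩, ?_⟩
    rw [← Submodule.Quotient.mk_eq_zero] at h
    simpa using h

theorem finrank_comap_torsion {M : Type*} [AddCommGroup M] [Module.Finite ℤ M]
    (N : Submodule ℤ M) :
    Module.finrank ℤ ((Submodule.torsion ℤ (M ⧸ N)).comap N.mkQ) = Module.finrank ℤ N := by
  set S := (Submodule.torsion ℤ (M ⧸ N)).comap N.mkQ
  have hle : N ≤ S := fun x hx => (mem_comap_torsion N x).2 ⟨1, one_ne_zero, by simpa using hx⟩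
  have h0 : Module.finrank ℤ (S ⧸ N.submoduleOf S) = 0 := by
    rw [Module.finrank_eq_zero_iff_isTorsion]
    intro x
    obtain ⟨x, rfl⟩ := Submodule.mkQ_surjective _ x
    obtain ⟨c, hc, h⟩ := (mem_comap_torsion N _).1 x.2
    refine ⟨⟨c, mem_nonZeroDivisors_of_ne_zero hc⟩, ?_⟩
    change (Submodule.Quotient.mk (c • x) : S ⧸ N.submoduleOf S) = 0
    rw [Submodule.Quotient.mk_eq_zero]
    exact h
  have h1 := Submodule.finrank_quotient_add_finrank (N.submoduleOf S)
  rw [h0, zero_add] at h1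
  rw [← h1]
  exact (Submodule.submoduleOfEquivOfLe hle).finrank_eq

theorem card_quotient_range_eq_natAbs_det {M : Type*} [AddCommGroup M] [Module.Free ℤ M]
    [Module.Finite ℤ M] (f : M →ₗ[ℤ] M) (hf : Function.Injective f) :
    Nat.card (M ⧸ LinearMap.range f) = (LinearMap.det f).natAbs := by
  rw [← Submodule.natAbs_det_equiv _ (LinearEquiv.ofInjective f hf)]
  rfl

/-- The torsion of the cokernel of an injective map `g` out of `ℤ^m` is measured by the determinant
of `g` in a basis of the saturation of its range. -/
theorem exists_matrix_card_torsion {m M : Type*} [Fintype m] [DecidableEq m] [AddCommGroup M]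
    (g : (m → ℤ) →ₗ[ℤ] M) (hg : Function.Injective g)
    (S : Submodule ℤ M) (hS : ∀ x, x ∈ S ↔ ∃ c : ℤ, c ≠ 0 ∧ c • x ∈ LinearMap.range g)
    (b : Module.Basis m ℤ S) :
    ∃ T : Matrix m m ℤ, Nat.card (Submodule.torsion ℤ (M ⧸ LinearMap.range g)) = T.det.natAbs ∧
      ∀ j, g (Pi.single j 1) = ∑ k, T k j • (b k : M) := by
  have hS' : S = (Submodule.torsion ℤ (M ⧸ LinearMap.range g)).comap (LinearMap.range g).mkQ := by
    ext x
    rw [hS, mem_comap_torsion]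
  have hmem : ∀ x, g x ∈ S := fun x => (hS _).2 ⟨1, one_ne_zero, by simp⟩
  let f : S →ₗ[ℤ] S := (g.codRestrict S hmem) ∘ₗ b.equivFun.toLinearMap
  have hf : Function.Injective f := by
    intro x y h
    exact b.equivFun.injective (hg (congrArg Subtype.val h))
  have hrange : LinearMap.range f = (LinearMap.range g).submoduleOf S := by
    ext x
    simp only [Submodule.submoduleOf, Submodule.mem_comap, LinearMap.mem_range]
    constructor
    · rintro ⟨y, rfl⟩
      exact ⟨b.equivFun y, rfl⟩
    · rintro ⟨y, hy⟩
      refine ⟨b.equivFun.symm y, Subtype.ext ?_⟩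
      change g (b.equivFun (b.equivFun.symm y)) = x
      rw [LinearEquiv.apply_symm_apply, hy]
      rfl
  have : Module.Free ℤ S := Module.Free.of_basis b
  have : Module.Finite ℤ S := Module.Finite.of_basis b
  refine ⟨LinearMap.toMatrix b b f, ?_, fun j => ?_⟩
  · rw [LinearMap.det_toMatrix, ← card_quotient_range_eq_natAbs_det f hf, hrange,
      card_torsion_quotient, ← hS']
  · have h : ((∑ k, b.repr (f (b j)) k • b k : S) : M) = f (b j) := by rw [b.sum_repr]
    have h2 : (f (b j) : M) = g (Pi.single j 1) := by
      have : b.equivFun (b j) = Pi.single j 1 := by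
        ext i; simp [Pi.single_apply, eq_comm]
      rw [← this]
      rfl
    rw [← h2, ← h]
    simp only [LinearMap.toMatrix_apply, Submodule.coe_sum, Submodule.coe_smul]

theorem torsOrd_eq_card_torsion_range {p q n : ℕ} {m : Type*} [Fintype m]
    (L : Matrix (Fin q) (Fin p) ℤ) (K : Matrix (Fin p) (Fin n) ℤ) (V : Finset (Fin n))
    (e : m ≃ {j // j ∈ V}) (g : (m → ℤ) →ₗ[ℤ] LinearMap.ker L.mulVecLin)
    (hg : ∀ x, (g x : Fin p → ℤ) = K.submatrix id (fun j => (e j : Fin n)) *ᵥ x) :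
    torsOrd L K V = Nat.card (Submodule.torsion ℤ
      (LinearMap.ker L.mulVecLin ⧸ LinearMap.range g)) := by
  have h : Submodule.comap (LinearMap.ker L.mulVecLin).subtype
      (LinearMap.range (colSubZ K V).mulVecLin) = LinearMap.range g := by
    have key : ∀ x : m → ℤ, (g x : Fin p → ℤ) = colSubZ K V *ᵥ (x ∘ e.symm) := by
      intro x
      rw [hg]
      ext i
      simp only [mulVec, dotProduct, submatrix_apply, id, colSubZ, Function.comp]
      exact Fintype.sum_equiv e _ _ (by simp)
    ext x
    simp only [Submodule.mem_comap, LinearMap.mem_range, mulVecLin_apply, Submodule.subtype_apply]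
    constructor
    · rintro ⟨y, hy⟩
      refine ⟨y ∘ e, Subtype.ext ?_⟩
      rw [key, ← hy]
      simp [Function.comp_assoc]
    · rintro ⟨y, rfl⟩
      exact ⟨_, (key y).symm⟩
  rw [torsOrd, h]

/-- If the columns of `C` are rational combinations of those of `C'`, then the column lattice of
`C` is contained in the saturation of that of `C'`. -/
theorem exists_smul_mulVec_of_map_eq_mul {p m m' : Type*} [Fintype m] [Fintype m']
    (C : Matrix p m ℤ) (C' : Matrix p m' ℤ) (A : Matrix m' m ℚ)
    (h : C.map (Int.cast : ℤ → ℚ) = C'.map (Int.cast : ℤ → ℚ) * A) :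
    ∃ d : ℤ, d ≠ 0 ∧ ∀ x, ∃ y, d • (C *ᵥ x) = C' *ᵥ y := by
  obtain ⟨d, hd⟩ := IsLocalization.exist_integer_multiples_of_finite (nonZeroDivisors ℤ)
    (fun ij : m' × m => A ij.1 ij.2)
  choose B hB using hd
  refine ⟨d, nonZeroDivisors.coe_ne_zero d, fun x => ⟨(of fun i j => B (i, j)) *ᵥ x, ?_⟩⟩
  have h' : (d : ℤ) • C = C' * of fun i j => B (i, j) := by
    ext i j
    have hij := congrFun (congrFun h i) j
    simp only [map_apply, mul_apply] at hij
    have hB' : ∀ k l, (B (k, l) : ℚ) = (d : ℤ) * A k l := by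
      intro k l
      have := hB (k, l)
      simpa using this
    have : (((d : ℤ) • C) i j : ℚ) = ((C' * of fun i j => B (i, j)) i j : ℤ) := by
      rw [Matrix.smul_apply, smul_eq_mul, mul_apply]
      push_cast
      simp only [of_apply]
      rw [hij, Finset.mul_sum]
      refine Finset.sum_congr rfl fun k _ => ?_
      rw [hB']
      ring
    exact_mod_cast this
  rw [mulVec_mulVec, ← h', smul_mulVec]

theorem mul_left_cancel_of_mulVec_injective {p m k R : Type*} [Fintype m] [CommRing R]
    {C : Matrix p m R} (hC : Function.Injective C.mulVec) {X Y : Matrix m k R}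
    (h : C * X = C * Y) : X = Y := by
  ext i j
  have : C *ᵥ (fun i => X i j) = C *ᵥ (fun i => Y i j) := by
    ext l
    exact congrFun (congrFun h l) j
  exact congrFun (hC this) i

theorem torsOrd_div_sq {p q n : ℕ} {m : Type*} [Fintype m] [DecidableEq m]
    (L : Matrix (Fin q) (Fin p) ℤ) (K : Matrix (Fin p) (Fin n) ℤ) (hLK : L * K = 0)
    (V₀ V : Finset (Fin n)) (e₀ : m ≃ {j // j ∈ V₀}) (e : m ≃ {j // j ∈ V}) (A : Matrix m m ℚ)
    (hinj : Function.Injective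
      ((K.map (Int.cast : ℤ → ℚ)).submatrix id (fun j => (e₀ j : Fin n))).mulVec)
    (hA : (K.map (Int.cast : ℤ → ℚ)).submatrix id (fun j => (e j : Fin n)) =
      (K.map (Int.cast : ℤ → ℚ)).submatrix id (fun j => (e₀ j : Fin n)) * A)
    (hdet : A.det ≠ 0) :
    ((torsOrd L K V : ℚ) / (torsOrd L K V₀ : ℚ)) ^ 2 = A.det ^ 2 := by
  set C₀ := K.submatrix id (fun j => (e₀ j : Fin n))
  set C := K.submatrix id (fun j => (e j : Fin n))
  change Function.Injective (C₀.map (Int.cast : ℤ → ℚ)).mulVec at hinj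
  change C.map (Int.cast : ℤ → ℚ) = C₀.map (Int.cast : ℤ → ℚ) * A at hA
  have hAu : IsUnit A.det := hdet.isUnit
  have hA' : C₀.map (Int.cast : ℤ → ℚ) = C.map (Int.cast : ℤ → ℚ) * A⁻¹ := by
    rw [hA, Matrix.mul_assoc, mul_nonsing_inv _ hAu, Matrix.mul_one]
  have hinjC : Function.Injective (C.map (Int.cast : ℤ → ℚ)).mulVec := by
    intro x y h
    rw [hA, ← mulVec_mulVec, ← mulVec_mulVec] at h
    exact mulVec_injective_iff_isUnit.2 ((isUnit_iff_isUnit_det _).2 hAu) (hinj h)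
  have intInj : ∀ D : Matrix (Fin p) m ℤ, Function.Injective (D.map (Int.cast : ℤ → ℚ)).mulVec →
      Function.Injective D.mulVec := by
    intro D hD x y h
    have : (D.map (Int.cast : ℤ → ℚ)) *ᵥ (fun i => (x i : ℚ)) =
        (D.map (Int.cast : ℤ → ℚ)) *ᵥ (fun i => (y i : ℚ)) := by
      ext i
      have := congrFun h i
      simp only [mulVec, dotProduct, map_apply] at this ⊢
      exact_mod_cast this
    ext i
    exact_mod_cast congrFun (hD this) i
  have kerMem : ∀ (c : m → Fin n) x,
      (K.submatrix id c).mulVecLin x ∈ LinearMap.ker L.mulVecLin := by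
    intro c x
    have : L * K.submatrix id c = 0 := by
      ext i j
      exact congrFun (congrFun hLK i) (c j)
    rw [LinearMap.mem_ker, mulVecLin_apply, mulVecLin_apply, mulVec_mulVec, this, zero_mulVec]
  let g₀ : (m → ℤ) →ₗ[ℤ] LinearMap.ker L.mulVecLin := C₀.mulVecLin.codRestrict _ (kerMem _)
  let g : (m → ℤ) →ₗ[ℤ] LinearMap.ker L.mulVecLin := C.mulVecLin.codRestrict _ (kerMem _)
  have hg₀ : Function.Injective g₀ := fun x y h => intInj _ hinj (congrArg Subtype.val h)
  have hg : Function.Injective g := fun x y h => intInj _ hinjC (congrArg Subtype.val h)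
  let S := (Submodule.torsion ℤ (_ ⧸ LinearMap.range g₀)).comap (LinearMap.range g₀).mkQ
  have hS₀ : ∀ x, x ∈ S ↔ ∃ c : ℤ, c ≠ 0 ∧ c • x ∈ LinearMap.range g₀ := mem_comap_torsion _
  have hS : ∀ x, x ∈ S ↔ ∃ c : ℤ, c ≠ 0 ∧ c • x ∈ LinearMap.range g := by
    intro x
    rw [hS₀]
    constructor
    · rintro ⟨c, hc, y, hy⟩
      obtain ⟨d, hd, h⟩ := exists_smul_mulVec_of_map_eq_mul _ _ _ hA'
      obtain ⟨w, hw⟩ := h y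
      refine ⟨d * c, mul_ne_zero hd hc, w, Subtype.ext ?_⟩
      rw [mul_smul, ← hy]
      exact hw.symm
    · rintro ⟨c, hc, y, hy⟩
      obtain ⟨d, hd, h⟩ := exists_smul_mulVec_of_map_eq_mul _ _ _ hA
      obtain ⟨w, hw⟩ := h y
      refine ⟨d * c, mul_ne_zero hd hc, w, Subtype.ext ?_⟩
      rw [mul_smul, ← hy]
      exact hw.symm
  have hrank : Module.finrank ℤ S = Fintype.card m := by
    rw [finrank_comap_torsion, LinearMap.finrank_range_of_inj hg₀,
      Module.finrank_fintype_fun_eq_card]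
  let b : Module.Basis m ℤ S :=
    (Module.finBasisOfFinrankEq ℤ S hrank).reindex (Fintype.equivFin m).symm
  obtain ⟨T₀, hT₀, hb₀⟩ := exists_matrix_card_torsion g₀ hg₀ S hS₀ b
  obtain ⟨T, hT, hb⟩ := exists_matrix_card_torsion g hg S hS b
  let P : Matrix (Fin p) m ℚ :=
    of fun i k => (((b k : LinearMap.ker L.mulVecLin) : Fin p → ℤ) i : ℚ)
  have factor : ∀ (D : Matrix (Fin p) m ℤ) (f : (m → ℤ) →ₗ[ℤ] LinearMap.ker L.mulVecLin)
      (U : Matrix m m ℤ), (∀ x, (f x : Fin p → ℤ) = D *ᵥ x) →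
      (∀ j, f (Pi.single j 1) = ∑ k, U k j • (b k : LinearMap.ker L.mulVecLin)) →
      D.map (Int.cast : ℤ → ℚ) = P * U.map (Int.cast : ℤ → ℚ) := by
    intro D f U hf hU
    ext i j
    have h := congrFun (congrArg Subtype.val (hU j)) i
    rw [hf, mulVec_single_one] at h
    simp only [Submodule.coe_sum, Submodule.coe_smul, Finset.sum_apply, Pi.smul_apply,
      smul_eq_mul] at h
    change D i j = _ at h
    simp only [map_apply, mul_apply, P, of_apply, h]
    push_cast
    exact Finset.sum_congr rfl fun k _ => mul_comm _ _
  have hP₀ := factor C₀ g₀ T₀ (fun _ => rfl) hb₀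
  have hP := factor C g T (fun _ => rfl) hb
  have hT₀u : IsUnit (T₀.map (Int.cast : ℤ → ℚ)).det := by
    rw [← isUnit_iff_isUnit_det, ← mulVec_injective_iff_isUnit]
    intro x y h
    apply hinj
    rw [hP₀, ← mulVec_mulVec, ← mulVec_mulVec, h]
  have hTA : T.map (Int.cast : ℤ → ℚ) = T₀.map (Int.cast : ℤ → ℚ) * A := by
    have : (T₀.map (Int.cast : ℤ → ℚ))⁻¹ * T.map (Int.cast : ℤ → ℚ) = A := by
      apply mul_left_cancel_of_mulVec_injective hinj
      rw [← hA, hP, hP₀, Matrix.mul_assoc, ← Matrix.mul_assoc (T₀.map _),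
        mul_nonsing_inv _ hT₀u, Matrix.one_mul]
    rw [← this, ← Matrix.mul_assoc, mul_nonsing_inv _ hT₀u, Matrix.one_mul]
  have hdetT : ∀ U : Matrix m m ℤ, (U.map (Int.cast : ℤ → ℚ)).det = U.det := fun U =>
    ((Int.castRingHom ℚ).map_det U).symm
  have hdets : (T.det : ℚ) = T₀.det * A.det := by rw [← hdetT, ← hdetT, hTA, det_mul]
  have hne : (T₀.det : ℚ) ≠ 0 := by rw [← hdetT]; exact hT₀u.ne_zero
  rw [torsOrd_eq_card_torsion_range L K V e g fun _ => rfl,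
    torsOrd_eq_card_torsion_range L K V₀ e₀ g₀ fun _ => rfl, hT, hT₀, div_pow,
    Nat.cast_natAbs, Nat.cast_natAbs, Int.cast_abs, Int.cast_abs, sq_abs, sq_abs, hdets]
  field_simp

theorem sum_mem_add_sum_notMem {ι M : Type*} [Fintype ι] [AddCommMonoid M] (V : Finset ι)
    [Fintype {i // i ∉ V}] (f : ι → M) :
    ∑ i : {i // i ∈ V}, f i + ∑ i : {i // i ∉ V}, f i = ∑ i, f i := by
  classical
  rw [← Fintype.sum_subtype_add_sum_subtype (· ∈ V) f]
  congr!

theorem isSpanningForest_iff_det_ne_zero {p n : ℕ} {K : Matrix (Fin p) (Fin n) ℤ}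
    {V₀ V : Finset (Fin n)} (hV₀ : IsSpanningForest K V₀) (hV : V.card = V₀.card)
    (e : {j // j ∈ V₀} ≃ {j // j ∈ V}) (A : Matrix {j // j ∈ V₀} {j // j ∈ V₀} ℚ)
    (hA : (K.map (Int.cast : ℤ → ℚ)).submatrix id (fun j => (e j : Fin n)) = colSubQ K V₀ * A) :
    IsSpanningForest K V ↔ A.det ≠ 0 := by
  have key : ∀ x, colSubQ K V *ᵥ x = colSubQ K V₀ *ᵥ (A *ᵥ (x ∘ e)) := by
    intro x
    have : colSubQ K V = ((K.map (Int.cast : ℤ → ℚ)).submatrix id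
        (fun j => (e j : Fin n))).submatrix id e.symm := by
      ext i j
      simp [colSubQ]
    rw [this, submatrix_mulVec_equiv, hA, mulVec_mulVec]
    rfl
  rw [IsSpanningForest, hV, and_iff_right hV₀.1, ← isUnit_iff_ne_zero, ← isUnit_iff_isUnit_det,
    ← mulVec_injective_iff_isUnit]
  constructor
  · intro h x y hxy
    have : x ∘ e.symm = y ∘ e.symm := by
      apply h
      simp only [mulVecLin_apply, key, Function.comp_assoc, Equiv.symm_comp_self, Function.comp_id]
      rw [hxy]
    exact e.symm.surjective.injective_comp_right this
  · intro h x y hxy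
    simp only [mulVecLin_apply, key] at hxy
    exact e.surjective.injective_comp_right (h (hV₀.2 hxy))

section GeometricBasis

variable {n : ℕ} {V₀ : Finset (Fin n)} {zfun : {σ : Fin n // σ ∉ V₀} → Fin n → ℚ}

theorem geometricCycle_apply
    (hz : ∀ σ, zfun σ σ.1 = 1 ∧ ∀ i, i ∉ V₀ → i ≠ σ.1 → zfun σ i = 0)
    (σ τ : {σ : Fin n // σ ∉ V₀}) : zfun σ τ = if σ = τ then 1 else 0 := by
  split_ifs with h
  · rw [← h, (hz σ).1]
  · exact (hz σ).2 _ τ.2 fun h' => h (Subtype.ext h'.symm)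

theorem dotProduct_eq_add_ite
    (hz : ∀ σ, zfun σ σ.1 = 1 ∧ ∀ i, i ∉ V₀ → i ≠ σ.1 → zfun σ i = 0) (σ τ) :
    zfun σ ⬝ᵥ zfun τ = (if σ = τ then 1 else 0) + ∑ i : {i // i ∈ V₀}, zfun σ i * zfun τ i := by
  rw [dotProduct, ← sum_mem_add_sum_notMem V₀, add_comm]
  congr 1
  simp [geometricCycle_apply hz]

/-- The coordinates of all columns in terms of the columns in `V₀`, as encoded by the geometric
cycles. -/
def coordMatrix (zfun : {σ : Fin n // σ ∉ V₀} → Fin n → ℚ) :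
    Matrix {j // j ∈ V₀} (Fin n) ℚ :=
  of fun i j => if hj : j ∈ V₀ then if i.1 = j then 1 else 0 else -zfun ⟨j, hj⟩ i

theorem map_eq_colSubQ_mul_coordMatrix {p : ℕ} (K : Matrix (Fin p) (Fin n) ℤ)
    (hz : ∀ σ, (K.map (Int.cast : ℤ → ℚ)) *ᵥ zfun σ = 0 ∧ zfun σ σ.1 = 1 ∧
      ∀ i, i ∉ V₀ → i ≠ σ.1 → zfun σ i = 0) :
    K.map (Int.cast : ℤ → ℚ) = colSubQ K V₀ * coordMatrix zfun := by
  ext l j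
  rw [mul_apply]
  by_cases hj : j ∈ V₀
  · rw [Finset.sum_eq_single ⟨j, hj⟩]
    · simp [colSubQ, coordMatrix, hj]
    · intro i _ hi
      have : i.1 ≠ j := fun h => hi (Subtype.ext h)
      simp [coordMatrix, hj, this]
    · simp
  · have h := congrFun (hz ⟨j, hj⟩).1 l
    rw [mulVec, dotProduct, ← sum_mem_add_sum_notMem V₀,
      Finset.sum_eq_single (⟨j, hj⟩ : {x // x ∉ V₀})] at h
    · simp only [(hz ⟨j, hj⟩).2.1, mul_one, Pi.zero_apply] at h
      rw [eq_neg_of_add_eq_zero_right h, ← Finset.sum_neg_distrib]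
      simp [colSubQ, coordMatrix, hj]
    · intro i _ hi
      rw [(hz ⟨j, hj⟩).2.2 i i.2 fun h => hi (Subtype.ext h), mul_zero]
    · simp

/-- `det (1 + B Bᵀ)` and the Weinstein–Aronszajn identity turn the principal minor of the mesh
matrix on `s` into a Gram determinant of the columns of `coordMatrix` indexed by `V₀ ∪ s`. -/
theorem det_mesh_submatrix_eq_det_mul_transpose
    (hz : ∀ σ, zfun σ σ.1 = 1 ∧ ∀ i, i ∉ V₀ → i ≠ σ.1 → zfun σ i = 0)
    (s : Finset {σ : Fin n // σ ∉ V₀}) (D : Matrix {j // j ∈ V₀} (Fin n) ℚ)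
    (hD : ∀ i j, D i j =
      if j ∈ V₀ ∪ s.map (Function.Embedding.subtype _) then coordMatrix zfun i j else 0) :
    ((of fun σ σ' => zfun σ ⬝ᵥ zfun σ').submatrix
      ((↑) : {x // x ∈ s} → {σ : Fin n // σ ∉ V₀}) (↑)).det = (D * Dᵀ).det := by
  let B : Matrix {x // x ∈ s} {j // j ∈ V₀} ℚ := of fun σ i => zfun σ i
  have h1 : (of fun σ σ' => zfun σ ⬝ᵥ zfun σ').submatrix
      ((↑) : {x // x ∈ s} → {σ : Fin n // σ ∉ V₀}) (↑) = 1 + B * Bᵀ := by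
    ext σ τ
    simp only [submatrix_apply, of_apply, dotProduct_eq_add_ite hz, Matrix.add_apply, one_apply,
      mul_apply, transpose_apply, B, Subtype.ext_iff]
  have h2 : D * Dᵀ = 1 + Bᵀ * B := by
    ext i j
    rw [mul_apply, ← sum_mem_add_sum_notMem V₀, Matrix.add_apply]
    congr 1
    · have : ∀ l : {l // l ∈ V₀}, D i l * Dᵀ l j =
          if i = l then (if j = l then 1 else 0) else 0 := by
        intro l
        rw [transpose_apply, hD, hD, if_pos (Finset.mem_union_left _ l.2),
          if_pos (Finset.mem_union_left _ l.2)]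
        simp only [coordMatrix, of_apply, dif_pos l.2, Subtype.ext_iff, ite_mul, one_mul, zero_mul]
      simp only [this]
      rw [Finset.sum_ite_eq, if_pos (Finset.mem_univ _), one_apply]
      exact if_congr eq_comm rfl rfl
    · have : ∀ σ : {σ // σ ∉ V₀}, D i σ * Dᵀ σ j =
          if σ ∈ s then zfun σ i * zfun σ j else 0 := by
        intro σ
        have hσ : σ.1 ∈ V₀ ∪ s.map (Function.Embedding.subtype _) ↔ σ ∈ s := by
          simp [σ.2]
        rw [transpose_apply, hD, hD]
        simp only [hσ]
        split_ifs with h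
        · simp [coordMatrix, σ.2]
        · simp
      simp_rw [this]
      rw [Finset.sum_ite_mem, Finset.univ_inter, ← Finset.sum_coe_sort, mul_apply]
      rfl
  rw [h1, h2, det_one_add_mul_comm]

open Classical in
theorem det_mesh_submatrix_eq_sum {p q : ℕ} (K : Matrix (Fin p) (Fin n) ℤ)
    (L : Matrix (Fin q) (Fin p) ℤ) (hLK : L * K = 0) (hV₀ : IsSpanningForest K V₀)
    (hz : ∀ σ, (K.map (Int.cast : ℤ → ℚ)) *ᵥ zfun σ = 0 ∧ zfun σ σ.1 = 1 ∧
      ∀ i, i ∉ V₀ → i ≠ σ.1 → zfun σ i = 0)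
    (s : Finset {σ : Fin n // σ ∉ V₀}) :
    ((of fun σ σ' => zfun σ ⬝ᵥ zfun σ').submatrix
      ((↑) : {x // x ∈ s} → {σ : Fin n // σ ∉ V₀}) (↑)).det =
      ∑ V ∈ Finset.univ.filter (fun V =>
          IsSpanningForest K V ∧ V ⊆ V₀ ∪ s.map (Function.Embedding.subtype _)),
        ((torsOrd L K V : ℚ) / (torsOrd L K V₀ : ℚ)) ^ 2 := by
  set W := V₀ ∪ s.map (Function.Embedding.subtype _) with hW
  let D : Matrix {j // j ∈ V₀} (Fin n) ℚ :=
    of fun i j => if j ∈ W then coordMatrix zfun i j else 0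
  let e : ∀ V : {V : Finset (Fin n) // V.card = Fintype.card {j // j ∈ V₀}},
      {j // j ∈ V₀} ≃ V.1 := fun V =>
    Finset.equivOfCardEq (by rw [V.2, Fintype.card_coe])
  have hdet := det_mesh_submatrix_eq_det_mul_transpose (fun σ => (hz σ).2) s D
    fun i j => by simp only [D, of_apply, hW]
  rw [det_mul_eq_sum_minors D Dᵀ e] at hdet
  have hfilter : (Finset.univ.filter fun V => IsSpanningForest K V ∧ V ⊆ W) =
      (Finset.univ.filter fun V : Finset (Fin n) => V.card = Fintype.card {j // j ∈ V₀}).filter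
        fun V => IsSpanningForest K V ∧ V ⊆ W := by
    ext V
    simp only [Finset.mem_filter, Finset.mem_univ, true_and, Fintype.card_coe]
    exact ⟨fun h => ⟨h.1.1.trans hV₀.1.symm, h⟩, fun h => h.2⟩
  rw [hfilter, Finset.sum_filter,
    Finset.sum_subtype (p := fun V => V.card = Fintype.card {j // j ∈ V₀}) _ (by simp)]
  rw [hdet]
  refine Finset.sum_congr rfl fun V _ => ?_
  have hT : (Dᵀ.submatrix (fun i => (e V i : Fin n)) id).det =
      (D.submatrix id fun i => (e V i : Fin n)).det := by
    rw [← det_transpose]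
    rfl
  rw [hT, ← sq]
  by_cases hVW : V.1 ⊆ W
  · have hDA : (D.submatrix id fun i => (e V i : Fin n)) =
        (coordMatrix zfun).submatrix id fun i => (e V i : Fin n) := by
      ext i j
      simp [D, hVW (e V j).2]
    have hA : (K.map (Int.cast : ℤ → ℚ)).submatrix id (fun j => (e V j : Fin n)) =
        colSubQ K V₀ * (coordMatrix zfun).submatrix id fun i => (e V i : Fin n) := by
      conv_lhs => rw [map_eq_colSubQ_mul_coordMatrix K hz]
      rfl
    have hiff := isSpanningForest_iff_det_ne_zero hV₀ (by rw [V.2, Fintype.card_coe]) (e V) _ hA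
    rw [hDA]
    by_cases hdet : ((coordMatrix zfun).submatrix id fun i => (e V i : Fin n)).det = 0
    · rw [if_neg fun h => hiff.1 h.1 hdet, hdet, zero_pow two_ne_zero]
    · rw [if_pos ⟨hiff.2 hdet, hVW⟩]
      exact (torsOrd_div_sq L K hLK V₀ V (Equiv.refl _) (e V) _ hV₀.2 hA hdet).symm
  · rw [if_neg fun h => hVW h.2]
    obtain ⟨x, hx, hxW⟩ := Finset.not_subset.1 hVW
    rw [det_eq_zero_of_column_eq_zero ((e V).symm ⟨x, hx⟩) (by simp [D, hxW]),
      zero_pow two_ne_zero]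

end GeometricBasis

open Classical in
/-- For a fixed spanning forest `V₀`: the geometric cycles `z(σ)` exist and are unique,
form a `ℚ`-basis of the rational cycle space, and every elementary symmetric function of
the eigenvalues of the geometric cycle mesh matrix `G` is a sum over `(U, V)` of
`(t(V)/t(V₀))²`. -/
theorem geometric_mesh_esymm
    {n p q : ℕ} (K : Matrix (Fin p) (Fin n) ℤ) (L : Matrix (Fin q) (Fin p) ℤ)
    (hLK : L * K = 0)
    (z : ℕ) (hz : z = n - (K.map (Int.cast : ℤ → ℚ)).rank)
    (V₀ : Finset (Fin n)) (hV₀ : IsSpanningForest K V₀)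
    (zfun : {σ : Fin n // σ ∉ V₀} → (Fin n → ℚ))
    (hzfun : ∀ σ : {σ : Fin n // σ ∉ V₀},
      Matrix.mulVecLin (K.map (Int.cast : ℤ → ℚ)) (zfun σ) = 0 ∧ zfun σ σ.1 = 1 ∧
        ∀ i, i ∉ V₀ → i ≠ σ.1 → zfun σ i = 0) :
    (∀ σ : Fin n, σ ∉ V₀ → ∃! v : Fin n → ℚ,
        Matrix.mulVecLin (K.map (Int.cast : ℤ → ℚ)) v = 0 ∧ v σ = 1 ∧
          ∀ i, i ∉ V₀ → i ≠ σ → v i = 0) ∧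
    (LinearIndependent ℚ zfun ∧
      Submodule.span ℚ (Set.range zfun) =
        LinearMap.ker (Matrix.mulVecLin (K.map (Int.cast : ℤ → ℚ)))) ∧
    (∀ k ≤ z,
      (∑ s ∈ Finset.powersetCard k (Finset.univ : Finset {σ : Fin n // σ ∉ V₀}),
        ((Matrix.of fun σ σ' => zfun σ ⬝ᵥ zfun σ').submatrix
          ((↑) : {x : {σ : Fin n // σ ∉ V₀} // x ∈ s} → {σ : Fin n // σ ∉ V₀})
          ((↑) : {x : {σ : Fin n // σ ∉ V₀} // x ∈ s} → {σ : Fin n // σ ∉ V₀})).det) =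
        ∑ U ∈ Finset.univ.filter (fun U : Finset (Fin n) => U ⊆ V₀ᶜ ∧ U.card = k),
          ∑ V ∈ Finset.univ.filter (fun V => IsSpanningForest K V ∧ V ⊆ V₀ ∪ U),
            ((torsOrd L K V : ℚ) / (torsOrd L K V₀ : ℚ))^2) := by
  have hz' : ∀ σ, (K.map (Int.cast : ℤ → ℚ)) *ᵥ zfun σ = 0 ∧ zfun σ σ.1 = 1 ∧
      ∀ i, i ∉ V₀ → i ≠ σ.1 → zfun σ i = 0 := hzfun
  have eq_zero : ∀ v : Fin n → ℚ, (K.map (Int.cast : ℤ → ℚ)) *ᵥ v = 0 →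
      (∀ i, i ∉ V₀ → v i = 0) → v = 0 := by
    intro v hv hsupp
    have h : colSubQ K V₀ *ᵥ (fun i => v i) = 0 := by
      ext l
      have hl := congrFun hv l
      rw [mulVec, dotProduct, ← sum_mem_add_sum_notMem V₀,
        Finset.sum_eq_zero (s := (Finset.univ : Finset {x // x ∉ V₀}))
          fun i _ => by rw [hsupp i i.2, mul_zero], add_zero] at hl
      exact hl
    have h0 := hV₀.2 (h.trans (mulVec_zero _).symm)
    ext i
    by_cases hi : i ∈ V₀
    · exact congrFun h0 ⟨i, hi⟩
    · exact hsupp i hi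
  have coord : ∀ σ τ : {σ : Fin n // σ ∉ V₀}, zfun σ τ = if σ = τ then 1 else 0 := by
    intro σ τ
    rw [geometricCycle_apply fun σ => (hz' σ).2]
  refine ⟨fun σ hσ => ⟨zfun ⟨σ, hσ⟩, hzfun ⟨σ, hσ⟩, ?_⟩, ⟨?_, ?_⟩, fun k _ => ?_⟩
  · rintro v ⟨hv, hvσ, hvsupp⟩
    obtain ⟨hw, hwσ, hwsupp⟩ := hz' ⟨σ, hσ⟩
    rw [← sub_eq_zero]
    refine eq_zero _ ?_ fun i hi => ?_
    · rw [mulVecLin_apply] at hv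
      rw [mulVec_sub, hv, hw, sub_zero]
    · by_cases h : i = σ
      · subst h
        rw [Pi.sub_apply, hvσ, hwσ, sub_self]
      · rw [Pi.sub_apply, hvsupp i hi h, hwsupp i hi h, sub_self]
  · rw [Fintype.linearIndependent_iff]
    intro c hc τ
    simpa [coord] using congrFun hc τ.1
  · refine le_antisymm (Submodule.span_le.2 ?_) fun v hv => ?_
    · rintro _ ⟨σ, rfl⟩
      exact (hzfun σ).1
    · have h : v = ∑ σ : {σ : Fin n // σ ∉ V₀}, v σ • zfun σ := by
        rw [← sub_eq_zero]
        refine eq_zero _ ?_ fun i hi => ?_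
        · rw [LinearMap.mem_ker] at hv
          rw [← mulVecLin_apply, map_sub, hv, map_sum,
            Finset.sum_eq_zero fun σ _ => by rw [map_smul, (hzfun σ).1, smul_zero], sub_zero]
        · have := fun σ => coord σ ⟨i, hi⟩
          simp only at this
          simp [this]
      rw [h]
      exact Submodule.sum_mem _ fun σ _ =>
        Submodule.smul_mem _ _ (Submodule.subset_span ⟨σ, rfl⟩)
  · refine Finset.sum_bij (fun s _ => s.map (Function.Embedding.subtype _)) ?_ ?_ ?_ ?_
    · intro s hs
      simp only [Finset.mem_powersetCard_univ] at hs
      simp only [Finset.mem_filter, Finset.mem_univ, true_and, Finset.card_map, hs, and_true]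
      intro x hx
      simp only [Finset.mem_map, Function.Embedding.subtype_apply] at hx
      obtain ⟨y, -, rfl⟩ := hx
      simpa using y.2
    · intro s _ t _ h
      exact Finset.map_injective _ h
    · intro U hU
      obtain ⟨-, hU, hk⟩ := Finset.mem_filter.1 hU
      have hmap : (U.subtype (· ∉ V₀)).map (Function.Embedding.subtype _) = U :=
        Finset.subtype_map_of_mem fun x hx => Finset.mem_compl.1 (hU hx)
      refine ⟨U.subtype (· ∉ V₀), ?_, hmap⟩
      rw [Finset.mem_powersetCard_univ, ← hk, ← Finset.card_map, hmap]
    · intro s _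
      convert det_mesh_submatrix_eq_sum K L hLK hV₀ hz' s
end

section
/- Let 1 ≤ u < n and let A be an invertible n×n real matrix. Let R be the u×n matrix obtained from A by deleting its last n−u rows (i.e. the first u rows of A), and let S be the (n−u)×n matrix obtained from (A⁻¹)ᵀ by deleting its first u rows. Then det(R·Rᵀ) = det(A)² · det(S·Sᵀ). -/
open Matrix

/-- Jacobi's complementary minor formula for principal blocks: if `M * N = 1`, the leading block
of `M` has determinant `M.det` times that of the complementary block of `N`. -/
theorem Matrix.det_toBlocks₁₁_of_mul_eq_one {R m n : Type*} [CommRing R] [Fintype m] [Fintype n]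
    [DecidableEq m] [DecidableEq n] {M N : Matrix (m ⊕ n) (m ⊕ n) R} (h : M * N = 1) :
    M.toBlocks₁₁.det = M.det * N.toBlocks₂₂.det := by
  have hMN := h
  rw [← fromBlocks_toBlocks M, ← fromBlocks_toBlocks N, fromBlocks_multiply, ← fromBlocks_one,
    fromBlocks_inj] at hMN
  obtain ⟨-, h₁₂, -, h₂₂⟩ := hMN
  have key : M * fromBlocks 1 N.toBlocks₁₂ 0 N.toBlocks₂₂ =
      fromBlocks M.toBlocks₁₁ 0 M.toBlocks₂₁ 1 := by
    conv_lhs => rw [← fromBlocks_toBlocks M]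
    simp [fromBlocks_multiply, h₁₂, h₂₂]
  simpa using (congrArg det key).symm

/-- For `A` an invertible `n×n` real matrix, `R` the first `u` rows of `A`, and `S` the
last `n−u` rows of `(A⁻¹)ᵀ`, one has `det(R·Rᵀ) = det(A)² · det(S·Sᵀ)`. -/
theorem det_first_rows_eq_det_sq_mul_det_last_rows_inv_transpose
    {n u : ℕ} (hu : 1 ≤ u) (hun : u < n)
    (A : Matrix (Fin n) (Fin n) ℝ) (hA : IsUnit A.det) :
    (((A.submatrix (fun i : Fin u => Fin.castLE hun.le i) id) *
        (A.submatrix (fun i : Fin u => Fin.castLE hun.le i) id)ᵀ).det) =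
      A.det ^ 2 *
        ((((A⁻¹)ᵀ).submatrix (fun i : Fin (n - u) => (⟨u + i.1, by omega⟩ : Fin n)) id) *
          (((A⁻¹)ᵀ).submatrix (fun i : Fin (n - u) => (⟨u + i.1, by omega⟩ : Fin n)) id)ᵀ).det := by
  have hinv : (A * Aᵀ) * ((A⁻¹)ᵀ * A⁻¹) = 1 := by
    rw [Matrix.mul_assoc, ← Matrix.mul_assoc Aᵀ, ← transpose_mul, nonsing_inv_mul A hA,
      transpose_one, Matrix.one_mul, mul_nonsing_inv A hA]
  let e : Fin u ⊕ Fin (n - u) ≃ Fin n :=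
    finSumFinEquiv.trans (finCongr (Nat.add_sub_of_le hun.le))
  have hblocks : (A * Aᵀ).submatrix e e * ((A⁻¹)ᵀ * A⁻¹).submatrix e e = 1 := by
    rw [submatrix_mul_equiv, hinv, submatrix_one_equiv]
  have hdet := det_toBlocks₁₁_of_mul_eq_one hblocks
  rw [det_submatrix_equiv_self, det_mul, det_transpose, ← sq] at hdet
  exact hdet
end

section
/- (Kalai) Let n ≥ 2 and 1 ≤ k ≤ n−1. The square matrix I^k_r·(I^k_r)ᵀ, of size C(n−1,k), has characteristic polynomial (t−1)^{C(n−2,k−1)} · (t−n)^{C(n−2,k)}; that is, its eigenvalues are 1 and n with respective multiplicities C(n−2,k−1) and C(n−2,k). -/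
open Matrix Polynomial

/-- The simplicial boundary matrix: rows indexed by the `a`-element subsets of `Fin n`,
columns by the `b`-element subsets; the entry in row `r`, column `c` is `(−1)^i` if `r` is
obtained from `c` by deleting its `i`-th smallest element, and `0` otherwise.
(For `b = a + 1` this is the boundary map `∂` of the simplex on `Fin n`.) -/
def simplexBdry (n a b : ℕ) :
    Matrix {s : Finset (Fin n) // s.card = a} {s : Finset (Fin n) // s.card = b} ℤ :=
  fun r c => ∑ x ∈ c.1,
    if r.1 = c.1.erase x then (-1 : ℤ) ^ ((c.1.filter (fun y => y < x)).card) else 0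

/-- The restricted incidence matrix `I^k_r`: the submatrix of `∂_k` consisting of the rows
indexed by the `k`-element subsets of `Fin n` not containing the vertex `0`. -/
def IkrMat (n k : ℕ) [NeZero n] :
    Matrix {s : Finset (Fin n) // s.card = k ∧ (0 : Fin n) ∉ s}
      {s : Finset (Fin n) // s.card = k + 1} ℤ :=
  fun r c => simplexBdry n k (k + 1) ⟨r.1, r.2.1⟩ c

theorem Fintype.sum_subtype_eq_sum_of_ne_zero {β M : Type*} [Fintype β] [AddCommMonoid M]
    (p : β → Prop) [DecidablePred p] (f : β → M) (h : ∀ b, f b ≠ 0 → p b) :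
    ∑ b : {b // p b}, f b = ∑ b, f b := by
  rw [← Finset.sum_filter_of_ne fun b _ => h b,
    Finset.sum_subtype (p := p) _ fun b => by simp]

theorem Matrix.exists_charpoly_eq_of_sub_mul_sub_eq_zero {K ι : Type*} [Field K] [IsAlgClosed K]
    [Fintype ι] [DecidableEq ι] (A : Matrix ι ι K) (a b : K)
    (h : (A - algebraMap K _ a) * (A - algebraMap K _ b) = 0) :
    ∃ i j : ℕ, A.charpoly = (X - C a) ^ i * (X - C b) ^ j ∧ i + j = Fintype.card ι ∧
      A.trace = i * a + j * b := by
  classical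
  have hroot : ∀ x ∈ A.charpoly.roots, x = a ∨ x = b := by
    intro x hx
    have hx : x ∈ spectrum K A :=
      Matrix.mem_spectrum_iff_isRoot_charpoly.2 (Polynomial.isRoot_of_mem_roots hx)
    by_contra! hne
    have hmem := spectrum.subset_polynomial_aeval A ((X - C a) * (X - C b)) ⟨x, hx, rfl⟩
    have h0 : aeval A ((X - C a) * (X - C b)) = 0 := by simpa using h
    have : Nonempty ι := by
      by_contra hι
      rw [not_nonempty_iff] at hι
      exact hx (isUnit_of_subsingleton _)
    rw [h0, spectrum.zero_eq] at hmem
    simp [sub_eq_zero, hne.1, hne.2] at hmem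
  obtain ⟨i, j, hij⟩ :
      ∃ i j : ℕ, A.charpoly.roots = Multiset.replicate i a + Multiset.replicate j b := by
    refine ⟨(A.charpoly.roots.filter (· = a)).card, (A.charpoly.roots.filter (¬ · = a)).card, ?_⟩
    conv_lhs => rw [← Multiset.filter_add_not (· = a) A.charpoly.roots]
    congr 1
    · exact Multiset.eq_replicate_card.2 fun x hx => (Multiset.mem_filter.1 hx).2
    · exact Multiset.eq_replicate_card.2 fun x hx =>
        (hroot x (Multiset.mem_filter.1 hx).1).resolve_left (Multiset.mem_filter.1 hx).2
  have hsplit : A.charpoly.Splits := IsAlgClosed.splits _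
  refine ⟨i, j, ?_, ?_, ?_⟩
  · rw [hsplit.eq_prod_roots_of_monic A.charpoly_monic, hij]
    simp
  · rw [← A.charpoly_natDegree_eq_dim, hsplit.natDegree_eq_card_roots, hij]
    simp
  · rw [Matrix.trace_eq_sum_roots_charpoly, hij]
    simp

/-- The integral version of `Matrix.exists_charpoly_eq_of_sub_mul_sub_eq_zero`. -/
theorem Matrix.exists_charpoly_eq_of_sub_mul_sub_eq_zero_int {ι : Type*}
    [Fintype ι] [DecidableEq ι] (A : Matrix ι ι ℤ) (a b : ℤ)
    (h : (A - algebraMap ℤ _ a) * (A - algebraMap ℤ _ b) = 0) :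
    ∃ i j : ℕ, A.charpoly = (X - C a) ^ i * (X - C b) ^ j ∧ i + j = Fintype.card ι ∧
      A.trace = i * a + j * b := by
  have hmap : ∀ z : ℤ, (Int.castRingHom ℂ).mapMatrix (algebraMap ℤ (Matrix ι ι ℤ) z) =
      algebraMap ℂ (Matrix ι ι ℂ) (z : ℂ) := by
    intro z
    simp
  obtain ⟨i, j, hA, hcard, htr⟩ :=
    ((Int.castRingHom ℂ).mapMatrix A).exists_charpoly_eq_of_sub_mul_sub_eq_zero (a : ℂ) b (by
      rw [← hmap, ← hmap, ← map_sub, ← map_sub, ← map_mul, h, map_zero])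
  refine ⟨i, j, ?_, hcard, ?_⟩
  · apply Polynomial.map_injective (Int.castRingHom ℂ) Int.cast_injective
    rw [← Matrix.charpoly_map]
    simpa using hA
  · have : ((A.trace : ℤ) : ℂ) = i * a + j * b := by
      rw [← htr]
      simp [Matrix.trace]
    exact_mod_cast this

section Annihilation

variable {α : Type*} [LinearOrder α]

/-- The sign `(-1)^i`, where `i` is the number of elements of `c` smaller than `x`. -/
def Finset.positionSign (x : α) (c : Finset α) : ℤ :=
  (-1) ^ (c.filter (· < x)).card

theorem Finset.positionSign_mul_self (x : α) (c : Finset α) :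
    c.positionSign x * c.positionSign x = 1 := by
  rw [positionSign, ← mul_pow]
  simp

theorem Finset.positionSign_insert {x y : α} {c : Finset α} (hy : y ∉ c) :
    (insert y c).positionSign x = if y < x then -c.positionSign x else c.positionSign x := by
  unfold positionSign
  rw [Finset.filter_insert]
  split_ifs
  · rw [Finset.card_insert_of_notMem (by simp [hy]), pow_succ]
    ring
  · rfl

theorem Finset.positionSign_erase {x y : α} {c : Finset α} (hy : y ∈ c) :
    (c.erase y).positionSign x = if y < x then -c.positionSign x else c.positionSign x := by
  have h := Finset.positionSign_insert (x := x) (Finset.notMem_erase y c)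
  rw [Finset.insert_erase hy] at h
  split_ifs at h ⊢ <;> simp [h]

/-- The matrix of the signed deletion of the vertex `x`, on the chains of all degrees. -/
def annihilation (x : α) : Matrix (Finset α) (Finset α) ℤ :=
  Matrix.of fun r c => if x ∈ c ∧ r = c.erase x then c.positionSign x else 0

theorem annihilation_transpose_apply (x : α) (r c : Finset α) :
    (annihilation x)ᵀ r c = if x ∉ c ∧ r = insert x c then c.positionSign x else 0 := by
  have hiff : (x ∈ r ∧ c = r.erase x) ↔ (x ∉ c ∧ r = insert x c) := by
    constructor
    · rintro ⟨hx, rfl⟩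
      simp [hx]
    · rintro ⟨hx, rfl⟩
      simp [hx]
  simp only [annihilation, Matrix.transpose_apply, Matrix.of_apply, hiff]
  split_ifs with h
  · rw [h.2, Finset.positionSign_insert h.1, if_neg (lt_irrefl x)]
  · rfl

/-- The boundary operator on chains of all degrees that only deletes vertices of `S`. -/
def partialBdry (S : Finset α) : Matrix (Finset α) (Finset α) ℤ :=
  ∑ x ∈ S, annihilation x

theorem partialBdry_apply (S r c : Finset α) :
    partialBdry S r c = ∑ x ∈ S, if x ∈ c ∧ r = c.erase x then c.positionSign x else 0 := by
  simp [partialBdry, Matrix.sum_apply, annihilation]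

theorem card_eq_of_partialBdry_apply_ne_zero {S r c : Finset α} (h : partialBdry S r c ≠ 0) :
    c.card = r.card + 1 := by
  rw [partialBdry_apply] at h
  obtain ⟨x, _, hx⟩ := Finset.exists_ne_zero_of_sum_ne_zero h
  obtain ⟨hxc, rfl⟩ := (ite_ne_right_iff.1 hx).1
  exact (Finset.card_erase_add_one hxc).symm

theorem mem_iff_of_partialBdry_apply_ne_zero {S r c : Finset α} (h : partialBdry S r c ≠ 0)
    {v : α} (hv : v ∉ S) : v ∈ c ↔ v ∈ r := by
  rw [partialBdry_apply] at h
  obtain ⟨x, hxS, hx⟩ := Finset.exists_ne_zero_of_sum_ne_zero h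
  obtain ⟨hxc, rfl⟩ := (ite_ne_right_iff.1 hx).1
  simp [show v ≠ x by rintro rfl; exact hv hxS]

variable [Fintype α]

theorem mul_annihilation_apply (M : Matrix (Finset α) (Finset α) ℤ) (x : α) (r c : Finset α) :
    (M * annihilation x) r c = if x ∈ c then M r (c.erase x) * c.positionSign x else 0 := by
  simp only [Matrix.mul_apply, annihilation, Matrix.of_apply]
  split_ifs with h <;> simp [h]

theorem mul_annihilation_transpose_apply (M : Matrix (Finset α) (Finset α) ℤ) (x : α)
    (r c : Finset α) :
    (M * (annihilation x)ᵀ) r c = if x ∉ c then M r (insert x c) * c.positionSign x else 0 := by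
  simp only [Matrix.mul_apply, annihilation_transpose_apply]
  split_ifs with h <;> simp [h]

theorem annihilation_mul_annihilation_add (x y : α) :
    annihilation x * annihilation y + annihilation y * annihilation x = 0 := by
  ext r c
  simp only [Matrix.add_apply, mul_annihilation_apply, Matrix.zero_apply]
  rcases eq_or_ne x y with rfl | hxy
  · simp [annihilation]
  by_cases hx : x ∈ c <;> by_cases hy : y ∈ c <;>
    simp [annihilation, hx, hy, hxy, hxy.symm]
  rw [Finset.erase_right_comm, Finset.positionSign_erase hx, Finset.positionSign_erase hy]
  rcases hxy.lt_or_gt with h | h <;> simp only [h, h.not_gt, if_true, if_false] <;>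
    split_ifs <;> ring

theorem annihilation_mul_transpose_add (x y : α) :
    annihilation x * (annihilation y)ᵀ + (annihilation y)ᵀ * annihilation x =
      if x = y then 1 else 0 := by
  ext r c
  simp only [Matrix.add_apply, mul_annihilation_apply, mul_annihilation_transpose_apply,
    annihilation_transpose_apply]
  rcases eq_or_ne x y with rfl | hxy
  · by_cases hx : x ∈ c
    · simp only [hx, Finset.insert_erase, if_true]
      rcases eq_or_ne r c with rfl | hr <;>
        simp [*, Finset.positionSign_erase hx, Finset.positionSign_mul_self]
    · rcases eq_or_ne r c with rfl | hr <;>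
        simp [*, annihilation, Finset.positionSign_insert hx, Finset.positionSign_mul_self]
  by_cases hx : x ∈ c <;> by_cases hy : y ∈ c <;>
    simp [annihilation, hx, hy, hxy, hxy.symm]
  rw [Finset.erase_insert_of_ne hxy.symm, Finset.positionSign_erase hx,
    Finset.positionSign_insert hy]
  rcases hxy.lt_or_gt with h | h <;> simp only [h, h.not_gt, if_true, if_false] <;>
    split_ifs <;> ring

theorem partialBdry_mul_self (S : Finset α) : partialBdry S * partialBdry S = 0 := by
  have h : partialBdry S * partialBdry S + partialBdry S * partialBdry S = 0 := by
    simp only [partialBdry, Finset.sum_mul_sum]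
    conv_lhs => rhs; rw [Finset.sum_comm]
    simp only [← Finset.sum_add_distrib, annihilation_mul_annihilation_add, Finset.sum_const_zero]
  ext r c
  have := congrFun (congrFun h r) c
  simp only [Matrix.add_apply, Matrix.zero_apply] at this ⊢
  omega

theorem partialBdry_mul_transpose_add (S : Finset α) :
    partialBdry S * (partialBdry S)ᵀ + (partialBdry S)ᵀ * partialBdry S = (S.card : ℤ) • 1 := by
  simp only [partialBdry, Matrix.transpose_sum, Finset.sum_mul_sum]
  conv_lhs => rhs; rw [Finset.sum_comm]
  simp only [← Finset.sum_add_distrib, annihilation_mul_transpose_add]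
  simp

theorem partialBdry_laplacian_mul_self (S : Finset α) :
    (partialBdry S * (partialBdry S)ᵀ) * (partialBdry S * (partialBdry S)ᵀ) =
      (S.card : ℤ) • (partialBdry S * (partialBdry S)ᵀ) := by
  have h : (partialBdry S)ᵀ * partialBdry S =
      (S.card : ℤ) • 1 - partialBdry S * (partialBdry S)ᵀ :=
    eq_sub_of_add_eq' (partialBdry_mul_transpose_add S)
  calc _ = partialBdry S * ((partialBdry S)ᵀ * partialBdry S) * (partialBdry S)ᵀ := by
        simp only [Matrix.mul_assoc]
    _ = _ := by
        rw [h, Matrix.mul_sub, ← Matrix.mul_assoc, partialBdry_mul_self, Matrix.zero_mul,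
          sub_zero, Matrix.mul_smul, Matrix.mul_one, Matrix.smul_mul]

theorem partialBdry_laplacian_apply_self (S c : Finset α) :
    (partialBdry S * (partialBdry S)ᵀ) c c = ((S \ c).card : ℤ) := by
  simp only [partialBdry, Matrix.transpose_sum, Finset.sum_mul_sum, Matrix.sum_apply,
    mul_annihilation_transpose_apply]
  have : ∀ x ∈ S, (∑ y ∈ S, if y ∉ c then
      annihilation x c (insert y c) * c.positionSign y else 0) = if x ∉ c then 1 else 0 := by
    intro x hx
    rw [Finset.sum_eq_single x]
    · by_cases h : x ∈ c
      · simp [h]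
      · simp [annihilation, h, Finset.positionSign_insert h, Finset.positionSign_mul_self]
    · intro y _ hyx
      by_cases h : y ∈ c
      · simp [h]
      · have : c ≠ (insert y c).erase x := fun he => h (by rw [he]; simp [hyx])
        simp [annihilation, this]
    · exact fun h => absurd hx h
  rw [Finset.sum_congr rfl this, Finset.sum_boole, Finset.sdiff_eq_filter]

theorem card_and_mem_iff_of_partialBdry_laplacian_ne_zero {S r s : Finset α}
    (h : (partialBdry S * (partialBdry S)ᵀ) r s ≠ 0) :
    r.card = s.card ∧ ∀ v ∉ S, (v ∈ r ↔ v ∈ s) := by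
  rw [Matrix.mul_apply] at h
  obtain ⟨c, _, hc⟩ := Finset.exists_ne_zero_of_sum_ne_zero h
  have hr := left_ne_zero_of_mul hc
  have hs : partialBdry S s c ≠ 0 := right_ne_zero_of_mul hc
  refine ⟨?_, fun v hv => ?_⟩
  · have := card_eq_of_partialBdry_apply_ne_zero hr
    have := card_eq_of_partialBdry_apply_ne_zero hs
    omega
  · rw [← mem_iff_of_partialBdry_apply_ne_zero hr hv, mem_iff_of_partialBdry_apply_ne_zero hs hv]

/-- On faces avoiding the vertex `v`, the cofaces through `v` contribute the identity to the
full up-Laplacian. -/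
theorem partialBdry_univ_laplacian_apply {v : α} {r s : Finset α} (hr : v ∉ r) (hs : v ∉ s) :
    (partialBdry (Finset.univ : Finset α) * (partialBdry (Finset.univ : Finset α))ᵀ) r s =
      (1 + partialBdry (Finset.univ.erase v) * (partialBdry (Finset.univ.erase v))ᵀ) r s := by
  set D := partialBdry (Finset.univ.erase v)
  have hsplit : partialBdry Finset.univ = annihilation v + D :=
    (Finset.add_sum_erase _ _ (Finset.mem_univ v)).symm
  have hvv : (annihilation v * (annihilation v)ᵀ) r s = (1 : Matrix _ _ ℤ) r s := by
    have h := congrFun (congrFun (annihilation_mul_transpose_add v v) r) s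
    simpa [Matrix.add_apply, mul_annihilation_apply, hs] using h
  have hcross : ∀ r s : Finset α, v ∉ r → (D * (annihilation v)ᵀ) r s = 0 := by
    intro r s hr
    rw [mul_annihilation_transpose_apply]
    refine ite_eq_right_iff.2 fun _ => ?_
    by_contra hne
    have := mem_iff_of_partialBdry_apply_ne_zero (left_ne_zero_of_mul hne)
      (Finset.notMem_erase v _)
    exact hr (this.1 (Finset.mem_insert_self v s))
  have hcross' : (annihilation v * Dᵀ) r s = 0 := by
    have h := hcross s r hs
    rwa [← Matrix.transpose_apply (D * (annihilation v)ᵀ), Matrix.transpose_mul,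
      Matrix.transpose_transpose] at h
  rw [hsplit, Matrix.transpose_add, Matrix.add_mul, Matrix.mul_add, Matrix.mul_add]
  simp only [Matrix.add_apply, hvv, hcross r s hr, hcross', add_zero, zero_add]

end Annihilation

theorem simplexBdry_apply (n a b : ℕ) (r : {s : Finset (Fin n) // s.card = a})
    (c : {s : Finset (Fin n) // s.card = b}) :
    simplexBdry n a b r c = partialBdry Finset.univ r.1 c.1 := by
  rw [partialBdry_apply, simplexBdry]
  simp only [ite_and, Finset.sum_ite_mem, Finset.univ_inter]
  rfl

theorem IkrMat_mul_transpose (n k : ℕ) [NeZero n] :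
    IkrMat n k * (IkrMat n k)ᵀ = 1 + (partialBdry (Finset.univ.erase (0 : Fin n)) *
      (partialBdry (Finset.univ.erase 0))ᵀ).submatrix Subtype.val Subtype.val := by
  ext r s
  trans (partialBdry (Finset.univ : Finset (Fin n)) *
    (partialBdry (Finset.univ : Finset (Fin n)))ᵀ) r.1 s.1
  · simp only [Matrix.mul_apply, Matrix.transpose_apply, IkrMat, simplexBdry_apply]
    refine Fintype.sum_subtype_eq_sum_of_ne_zero (fun c => c.card = k + 1)
      (fun c => partialBdry Finset.univ r.1 c * partialBdry Finset.univ s.1 c) fun c hc => ?_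
    rw [card_eq_of_partialBdry_apply_ne_zero (left_ne_zero_of_mul hc), r.2.1]
  · rw [partialBdry_univ_laplacian_apply r.2.2 s.2.2]
    simp [Matrix.one_apply, Subtype.ext_iff]

theorem submatrix_partialBdry_laplacian_mul_self (n k : ℕ) [NeZero n]
    {L : Matrix {s : Finset (Fin n) // s.card = k ∧ (0 : Fin n) ∉ s}
      {s : Finset (Fin n) // s.card = k ∧ (0 : Fin n) ∉ s} ℤ}
    (hL : L = (partialBdry (Finset.univ.erase (0 : Fin n)) *
      (partialBdry (Finset.univ.erase 0))ᵀ).submatrix Subtype.val Subtype.val) :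
    L * L = ((n : ℤ) - 1) • L := by
  have hn : (((Finset.univ.erase (0 : Fin n)).card : ℕ) : ℤ) = n - 1 := by
    rw [Finset.card_erase_of_mem (Finset.mem_univ _), Finset.card_univ, Fintype.card_fin,
      Nat.cast_pred (NeZero.pos n)]
  subst hL
  rw [← hn]
  set S := Finset.univ.erase (0 : Fin n)
  ext r s
  rw [Matrix.smul_apply, Matrix.submatrix_apply, ← Matrix.smul_apply,
    ← partialBdry_laplacian_mul_self, Matrix.mul_apply, Matrix.mul_apply]
  refine Fintype.sum_subtype_eq_sum_of_ne_zero (fun c : Finset (Fin n) => c.card = k ∧ 0 ∉ c)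
    (fun c => (partialBdry S * (partialBdry S)ᵀ) r.1 c *
      (partialBdry S * (partialBdry S)ᵀ) c s.1) fun c hc => ?_
  obtain ⟨hcard, hmem⟩ :=
    card_and_mem_iff_of_partialBdry_laplacian_ne_zero (left_ne_zero_of_mul hc)
  rw [← hcard, ← hmem 0 (Finset.notMem_erase 0 _)]
  exact r.2

theorem card_subtype_card_eq_and_zero_notMem (n k : ℕ) [NeZero n] :
    Fintype.card {s : Finset (Fin n) // s.card = k ∧ (0 : Fin n) ∉ s} = (n - 1).choose k := by
  rw [Fintype.card_subtype]
  have : (Finset.univ.filter fun s : Finset (Fin n) => s.card = k ∧ (0 : Fin n) ∉ s) =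
      (Finset.univ.erase 0).powersetCard k := by
    ext s
    simp [Finset.mem_powersetCard, Finset.subset_erase, and_comm]
  rw [this, Finset.card_powersetCard, Finset.card_erase_of_mem (Finset.mem_univ _),
    Finset.card_univ, Fintype.card_fin]

theorem trace_IkrMat_mul_transpose (n k : ℕ) [NeZero n] :
    (IkrMat n k * (IkrMat n k)ᵀ).trace = (n - 1).choose k * ((n : ℤ) - k) := by
  have hdiag : ∀ s, (IkrMat n k * (IkrMat n k)ᵀ) s s = (n : ℤ) - k := by
    rintro ⟨s, hs, h0⟩
    rw [IkrMat_mul_transpose, Matrix.add_apply, Matrix.one_apply_eq, Matrix.submatrix_apply,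
      partialBdry_laplacian_apply_self]
    have hsub : s ⊆ Finset.univ.erase 0 := Finset.subset_erase.2 ⟨Finset.subset_univ s, h0⟩
    have h := Finset.card_sdiff_add_card_eq_card hsub
    rw [Finset.card_erase_of_mem (Finset.mem_univ _), Finset.card_univ, Fintype.card_fin, hs] at h
    have := NeZero.pos n
    simp only
    omega
  simp only [Matrix.trace, Matrix.diag_apply, hdiag, Finset.sum_const, Finset.card_univ,
    card_subtype_card_eq_and_zero_notMem, nsmul_eq_mul]

/-- (Kalai) `I^k_r·(I^k_r)ᵀ` has characteristic polynomial
`(t−1)^{C(n−2,k−1)} · (t−n)^{C(n−2,k)}`. -/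
theorem kalai_charpoly_Ikr
    (n k : ℕ) [NeZero n] (hn : 2 ≤ n) (hk1 : 1 ≤ k) (hk : k ≤ n - 1) :
    (IkrMat n k * (IkrMat n k)ᵀ).charpoly =
      (X - 1) ^ Nat.choose (n - 2) (k - 1) *
        (X - (n : ℤ[X])) ^ Nat.choose (n - 2) k := by
  set L := (partialBdry (Finset.univ.erase (0 : Fin n)) *
    (partialBdry (Finset.univ.erase 0))ᵀ).submatrix
      (Subtype.val : {s : Finset (Fin n) // s.card = k ∧ (0 : Fin n) ∉ s} → _) Subtype.val with hL
  have hquad : (IkrMat n k * (IkrMat n k)ᵀ - algebraMap ℤ _ 1) *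
      (IkrMat n k * (IkrMat n k)ᵀ - algebraMap ℤ _ (n : ℤ)) = 0 := by
    rw [IkrMat_mul_transpose, ← hL, map_one, Algebra.algebraMap_eq_smul_one, add_sub_cancel_left,
      mul_sub, mul_add, submatrix_partialBdry_laplacian_mul_self n k hL, mul_smul_comm, mul_one,
      sub_smul, one_smul]
    abel
  obtain ⟨i, j, hchar, hcard, htr⟩ :=
    Matrix.exists_charpoly_eq_of_sub_mul_sub_eq_zero_int _ _ _ hquad
  rw [card_subtype_card_eq_and_zero_notMem] at hcard
  rw [trace_IkrMat_mul_transpose] at htr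
  obtain ⟨m, rfl⟩ := Nat.exists_eq_add_of_le' hn
  obtain ⟨l, rfl⟩ := Nat.exists_eq_add_of_le' hk1
  simp only [Nat.add_sub_cancel, show m + 2 - 1 = m + 1 by omega] at hk hcard htr ⊢
  have hj : j = m.choose (l + 1) := by
    have h := Nat.choose_mul_succ_eq m (l + 1)
    zify [hk] at h hcard
    push_cast at htr
    have : (m + 1 : ℤ) * j = (m + 1) * m.choose (l + 1) := by
      linear_combination -htr - hcard - h
    exact_mod_cast mul_left_cancel₀ (by positivity) this
  have hi : i = m.choose l := by
    rw [Nat.choose_succ_succ] at hcard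
    simp only [Nat.succ_eq_add_one] at hcard
    omega
  rw [hchar, hi, hj]
  simp
end

section
/- Let n ≥ 2 and 1 ≤ k ≤ n−1. Then I^k_r·(I^k_r)ᵀ = Id + Bd^k·(Bd^k)ᵀ, where both sides are square matrices indexed by the k-element subsets of Fin n not containing the vertex 0, and Bd^k is the boundary matrix of the face spanned by the vertices other than 0 (the submatrix of ∂_k whose rows are the k-element subsets not containing 0 and whose columns are the (k+1)-element subsets not containing 0). -/
open Matrix

/-- The boundary matrix of the face spanned by the vertices other than `0`: the submatrix
of `∂` with rows the `a`-element subsets not containing `0` and columns the `b`-element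
subsets not containing `0`. -/
def BdMat (n a b : ℕ) [NeZero n] :
    Matrix {s : Finset (Fin n) // s.card = a ∧ (0 : Fin n) ∉ s}
      {s : Finset (Fin n) // s.card = b ∧ (0 : Fin n) ∉ s} ℤ :=
  fun r c => simplexBdry n a b ⟨r.1, r.2.1⟩ ⟨c.1, c.2.1⟩

/-- The incidence number of two finite sets of vertices, for arbitrary cardinalities. -/
def incidence {n : ℕ} (r c : Finset (Fin n)) : ℤ :=
  ∑ x ∈ c, if r = c.erase x then (-1 : ℤ) ^ ((c.filter (fun y => y < x)).card) else 0

theorem incidence_of_zero_mem {n : ℕ} [NeZero n] {r c : Finset (Fin n)}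
    (hr : (0 : Fin n) ∉ r) (hc : (0 : Fin n) ∈ c) :
    incidence r c = if c = insert 0 r then 1 else 0 := by
  have h_erase : r = c.erase 0 ↔ c = insert 0 r := by
    constructor
    · rintro rfl
      exact (Finset.insert_erase hc).symm
    · rintro rfl
      exact (Finset.erase_insert hr).symm
  rw [incidence, Finset.sum_eq_single_of_mem 0 hc]
  · simp [h_erase]
  · intro x _ hx
    rw [if_neg]
    rintro rfl
    exact hr (Finset.mem_erase.2 ⟨hx.symm, hc⟩)

theorem sum_incidence_mul_incidence_of_zero_mem {n k : ℕ} [NeZero n] {r s : Finset (Fin n)}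
    (hr : (0 : Fin n) ∉ r) (hs : (0 : Fin n) ∉ s) (hcard : r.card = k) :
    ∑ c : Finset (Fin n) with c.card = k + 1 ∧ (0 : Fin n) ∈ c, incidence r c * incidence s c =
      if r = s then 1 else 0 := by
  have h_mem : insert 0 r ∈
      ({c | c.card = k + 1 ∧ (0 : Fin n) ∈ c} : Finset (Finset (Fin n))) := by
    simp [Finset.card_insert_of_notMem hr, hcard]
  rw [Finset.sum_eq_single_of_mem _ h_mem]
  · have h_insert : insert 0 r = insert 0 s ↔ r = s := by
      constructor
      · intro h
        rw [← Finset.erase_insert hr, h, Finset.erase_insert hs]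
      · rintro rfl
        rfl
    simp [incidence_of_zero_mem hr, incidence_of_zero_mem hs, h_insert]
  · intro c hc hne
    rw [incidence_of_zero_mem hr (Finset.mem_filter.1 hc).2.2, if_neg hne, zero_mul]

/-- `I^k_r·(I^k_r)ᵀ = Id + Bd^k·(Bd^k)ᵀ`. -/
theorem Ikr_mul_transpose_eq_one_add
    (n k : ℕ) [NeZero n] (hn : 2 ≤ n) (hk1 : 1 ≤ k) (hk : k ≤ n - 1) :
    IkrMat n k * (IkrMat n k)ᵀ = 1 + BdMat n k (k + 1) * (BdMat n k (k + 1))ᵀ := by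
  ext r s
  rw [Matrix.add_apply, Matrix.mul_apply, Matrix.mul_apply, Matrix.one_apply]
  refine (Finset.sum_subtype (p := fun c => c.card = k + 1)
    ({c | c.card = k + 1} : Finset (Finset (Fin n))) (by simp)
    (fun c => incidence r.1 c * incidence s.1 c)).symm.trans (Eq.trans ?_ (congrArg _
      (Finset.sum_subtype (p := fun c => c.card = k + 1 ∧ (0 : Fin n) ∉ c)
        ({c | c.card = k + 1 ∧ (0 : Fin n) ∉ c} : Finset (Finset (Fin n))) (by simp)
        (fun c => incidence r.1 c * incidence s.1 c))))
  rw [← Finset.sum_filter_add_sum_filter_not _ (fun c => (0 : Fin n) ∈ c),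
    Finset.filter_filter, Finset.filter_filter,
    sum_incidence_mul_incidence_of_zero_mem r.2.2 s.2.2 r.2.1]
  simp only [Subtype.ext_iff]
end

section
/- Let n ≥ 2 and 1 ≤ k ≤ n−1, and let Bd^k be the boundary matrix of the simplex on the (n−1)-element vertex set Fin n \ {0} (the submatrix of ∂_k whose rows are the k-element subsets of Fin n not containing 0 and whose columns are the (k+1)-element subsets not containing 0). Then the combinatorial Laplacian Bd^k·(Bd^k)ᵀ, a square matrix of size C(n−1,k), has characteristic polynomial t^{C(n−2,k−1)} · (t−(n−1))^{C(n−2,k)}; that is, its eigenvalues are 0 and n−1 with respective multiplicities C(n−2,k−1) and C(n−2,k). -/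
open Matrix Polynomial

/-- The sign `(−1)^i` with which the vertex `x` enters the simplex `insert x s`. -/
def vertexSign {α : Type*} [LinearOrder α] (s : Finset α) (x : α) : ℤ :=
  (-1) ^ (s.filter (· < x)).card

/-- The matrix that deletes the vertex `x`, with the sign of `x`, on all subsets of `α`. -/
def deleteVertex {α : Type*} [LinearOrder α] (x : α) : Matrix (Finset α) (Finset α) ℤ :=
  fun r c => if x ∉ r ∧ c = insert x r then vertexSign r x else 0

/-- The boundary matrix on all subsets of `α`, deleting only vertices of `S`. -/
def boundary {α : Type*} [LinearOrder α] (S : Finset α) : Matrix (Finset α) (Finset α) ℤ :=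
  ∑ x ∈ S, deleteVertex x

section

variable {α : Type*} [LinearOrder α]

lemma vertexSign_mul_self (s : Finset α) (x : α) : vertexSign s x * vertexSign s x = 1 := by
  rw [vertexSign, ← mul_pow]
  simp

lemma vertexSign_insert {s : Finset α} {x : α} (hx : x ∉ s) (y : α) :
    vertexSign (insert x s) y = (if x < y then -1 else 1) * vertexSign s y := by
  unfold vertexSign
  rw [Finset.filter_insert]
  split_ifs with h
  · rw [Finset.card_insert_of_notMem (by simp [hx]), pow_succ']
  · simp

lemma vertexSign_insert_self (s : Finset α) (x : α) :
    vertexSign (insert x s) x = vertexSign s x := by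
  simp [vertexSign, Finset.filter_insert]

lemma deleteVertex_mul_apply [Fintype α] (x : α) (B : Matrix (Finset α) (Finset α) ℤ)
    (r t : Finset α) :
    (deleteVertex x * B) r t = if x ∉ r then vertexSign r x * B (insert x r) t else 0 := by
  simp [mul_apply, deleteVertex, ite_and]

lemma deleteVertex_transpose_mul_apply [Fintype α] (x : α)
    (B : Matrix (Finset α) (Finset α) ℤ) (r t : Finset α) :
    ((deleteVertex x)ᵀ * B) r t =
      if x ∈ r then vertexSign (r.erase x) x * B (r.erase x) t else 0 := by
  simp only [mul_apply, deleteVertex, transpose_apply]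
  rw [Finset.sum_eq_single (r.erase x)]
  · by_cases h : x ∈ r <;> simp [h]
    grind
  · intro c _ hc
    rw [if_neg, zero_mul]
    rintro ⟨hx, rfl⟩
    simp [hx] at hc
  · simp

lemma deleteVertex_mul_deleteVertex [Fintype α] (x y : α) :
    deleteVertex x * deleteVertex y = -(deleteVertex y * deleteVertex x) := by
  ext r t
  rw [Matrix.neg_apply, deleteVertex_mul_apply, deleteVertex_mul_apply]
  unfold deleteVertex
  by_cases hxy : x = y
  · subst hxy
    simp
  by_cases hx : x ∈ r
  · simp [hx]
  by_cases hy : y ∈ r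
  · simp [hy]
  simp only [hx, hy, Finset.mem_insert, hxy, Ne.symm hxy, Finset.insert_comm y x,
    vertexSign_insert hx, vertexSign_insert hy]
  rcases lt_or_gt_of_ne hxy with h | h <;> simp [h, h.not_gt] <;> split_ifs <;> ring

lemma deleteVertex_anticommutator [Fintype α] (x y : α) :
    deleteVertex x * (deleteVertex y)ᵀ + (deleteVertex y)ᵀ * deleteVertex x =
      if x = y then 1 else 0 := by
  ext r t
  rw [Matrix.add_apply, deleteVertex_mul_apply, deleteVertex_transpose_mul_apply]
  simp only [deleteVertex, transpose_apply]
  by_cases hxy : x = y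
  · subst hxy
    by_cases hx : x ∈ r
    · have := vertexSign_mul_self (r.erase x) x
      simp [hx, one_apply, this, eq_comm]
    · have := vertexSign_mul_self r x
      by_cases hrt : r = t
      · subst hrt
        simp [hx, this]
      · have : ¬ (x ∉ t ∧ insert x r = insert x t) := by
          rintro ⟨h1, h2⟩
          apply hrt
          rw [← Finset.erase_insert hx, h2, Finset.erase_insert h1]
        simp [hx, one_apply, hrt, this]
  rw [if_neg hxy, Matrix.zero_apply]
  by_cases hx : x ∈ r
  · simp [hx, hxy]
  by_cases hy : y ∈ r
  · obtain ⟨q, hq, rfl⟩ : ∃ q, y ∉ q ∧ r = insert y q :=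
      ⟨r.erase y, by simp, (Finset.insert_erase hy).symm⟩
    have hxq : x ∉ q := fun h => hx (Finset.mem_insert_of_mem h)
    by_cases ht : t = insert x q
    · subst ht
      rw [Finset.erase_insert hq]
      simp only [hx, hy, hq, hxq, vertexSign_insert hq,
        vertexSign_insert hxq, Finset.mem_insert, Ne.symm hxy, Finset.insert_comm y x]
      rcases lt_or_gt_of_ne hxy with h | h <;> simp [h, h.not_gt] <;> ring
    · have : ¬ (y ∉ t ∧ insert x (insert y q) = insert y t) := by
        rintro ⟨h1, h2⟩
        apply ht
        rw [← Finset.erase_insert h1, ← h2, Finset.insert_comm, Finset.erase_insert]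
        simp [hq, Ne.symm hxy]
      simp [this, ht, hq, hxq]
  · have : ¬ (y ∉ t ∧ insert x r = insert y t) := by
      rintro ⟨h1, h2⟩
      have : y ∈ insert x r := h2 ▸ Finset.mem_insert_self y t
      simp [hy, Ne.symm hxy] at this
    simp [hy, this]

lemma boundary_mul_boundary [Fintype α] (S : Finset α) : boundary S * boundary S = 0 := by
  have h : boundary S * boundary S = -(boundary S * boundary S) := by
    conv_lhs => rw [boundary, Finset.sum_mul_sum, Finset.sum_comm]
    rw [boundary, Finset.sum_mul_sum, ← Finset.sum_neg_distrib]
    refine Finset.sum_congr rfl fun x _ => ?_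
    rw [← Finset.sum_neg_distrib]
    exact Finset.sum_congr rfl fun y _ => deleteVertex_mul_deleteVertex y x
  ext r t
  exact self_eq_neg.1 (congrFun (congrFun h r) t)

lemma boundary_anticommutator [Fintype α] (S : Finset α) :
    boundary S * (boundary S)ᵀ + (boundary S)ᵀ * boundary S = (S.card : ℤ) • 1 := by
  rw [boundary, transpose_sum, Finset.sum_mul_sum, Finset.sum_mul_sum, Finset.sum_comm,
    ← Finset.sum_add_distrib]
  simp_rw [← Finset.sum_add_distrib, deleteVertex_anticommutator]
  simp

/-- Up to the scalar `|S|`, the up-Laplacian is idempotent. -/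
lemma simplicialLaplacian_mul_self [Fintype α] (S : Finset α) :
    boundary S * (boundary S)ᵀ * (boundary S * (boundary S)ᵀ) =
      (S.card : ℤ) • (boundary S * (boundary S)ᵀ) := by
  have h := congrArg (· * (boundary S * (boundary S)ᵀ)) (boundary_anticommutator S)
  have h0 : (boundary S)ᵀ * boundary S * (boundary S * (boundary S)ᵀ) = 0 := by
    rw [mul_assoc, ← mul_assoc (boundary S) (boundary S), boundary_mul_boundary]
    simp
  simpa [add_mul, h0] using h

lemma simplicialLaplacian_apply_self [Fintype α] (S r : Finset α) :
    (boundary S * (boundary S)ᵀ) r r = ((S \ r).card : ℤ) := by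
  have h : ∀ x y : α, (deleteVertex x * (deleteVertex y)ᵀ) r r =
      if x = y then if x ∉ r then 1 else 0 else 0 := by
    intro x y
    rw [deleteVertex_mul_apply, transpose_apply, deleteVertex]
    by_cases hx : x ∈ r
    · simp [hx]
    by_cases hxy : x = y
    · subst hxy
      simp [hx, vertexSign_mul_self]
    · have : ¬ (y ∉ r ∧ insert x r = insert y r) := by
        rintro ⟨h1, h2⟩
        have : y ∈ insert x r := h2 ▸ Finset.mem_insert_self y r
        simp [h1, Ne.symm hxy] at this
      simp [hxy, this]
  rw [boundary, transpose_sum, Finset.sum_mul_sum]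
  simp only [Matrix.sum_apply, h]
  simp [Finset.sdiff_eq_filter, Finset.sum_ite]

lemma exists_of_boundary_ne_zero {S r c : Finset α} (h : boundary S r c ≠ 0) :
    ∃ x ∈ S, x ∉ r ∧ c = insert x r := by
  rw [boundary, Matrix.sum_apply] at h
  obtain ⟨x, hx, hne⟩ := Finset.exists_ne_zero_of_sum_ne_zero h
  exact ⟨x, hx, (ite_ne_right_iff.1 hne).1⟩

end

/-- Restricting a product of matrices to subtypes, when the nonzero entries of the rows of the
first factor lie in the middle subtype. -/
lemma submatrix_val_mul_submatrix_val {l m o R : Type*} [Fintype m] [NonUnitalNonAssocSemiring R]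
    (A : Matrix l m R) (B : Matrix m o R) {p : l → Prop} {q : m → Prop} {u : o → Prop}
    [Fintype {j // q j}] (h : ∀ i j, p i → A i j ≠ 0 → q j) :
    A.submatrix (Subtype.val : {i // p i} → l) (Subtype.val : {j // q j} → m) *
        B.submatrix Subtype.val (Subtype.val : {i // u i} → o) =
      (A * B).submatrix Subtype.val Subtype.val := by
  classical
  ext i t
  simp only [mul_apply, submatrix_apply]
  rw [← Finset.sum_filter_of_ne (p := q)
    fun j _ hj => h i.1 j i.2 fun h0 => hj (by rw [h0, zero_mul])]
  exact (Finset.sum_subtype _ (by simp) fun j => A i.1 j * B j t.1).symm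

lemma BdMat_eq_submatrix (n k : ℕ) [NeZero n] :
    BdMat n k (k + 1) = (boundary (Finset.univ.erase (0 : Fin n))).submatrix
      Subtype.val Subtype.val := by
  ext ⟨r, hr, hr0⟩ ⟨c, hc, hc0⟩
  simp only [BdMat, simplexBdry, submatrix_apply, boundary, Matrix.sum_apply]
  have hsub : c ⊆ Finset.univ.erase 0 := by simpa [Finset.subset_erase] using hc0
  rw [← Finset.sum_subset hsub]
  · refine Finset.sum_congr rfl fun x hx => ?_
    have hiff : r = c.erase x ↔ x ∉ r ∧ c = insert x r := by
      constructor
      · rintro rfl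
        simp [Finset.insert_erase hx]
      · rintro ⟨h1, rfl⟩
        rw [Finset.erase_insert h1]
    unfold deleteVertex
    rw [if_congr hiff rfl rfl]
    refine if_ctx_congr Iff.rfl (fun h => ?_) fun _ => rfl
    rw [h.2]
    exact vertexSign_insert_self r x
  · intro x _ hx
    refine if_neg fun h => hx ?_
    rw [h.2]
    exact Finset.mem_insert_self x r

lemma BdMat_mul_transpose (n k : ℕ) [NeZero n] :
    BdMat n k (k + 1) * (BdMat n k (k + 1))ᵀ =
      (boundary (Finset.univ.erase (0 : Fin n)) *
        (boundary (Finset.univ.erase (0 : Fin n)))ᵀ).submatrix Subtype.val Subtype.val := by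
  rw [BdMat_eq_submatrix, transpose_submatrix]
  refine submatrix_val_mul_submatrix_val _ _ ?_
  rintro r c ⟨hr, hr0⟩ h
  obtain ⟨x, hx, hxr, rfl⟩ := exists_of_boundary_ne_zero h
  refine ⟨by rw [Finset.card_insert_of_notMem hxr, hr], ?_⟩
  simp [hr0, (Finset.ne_of_mem_erase hx).symm]

/-- The characteristic polynomial of a scalar multiple of an idempotent integer matrix is
determined by its trace. -/
lemma charpoly_of_mul_self_eq_smul {ι : Type*} [Fintype ι] [DecidableEq ι] (A : Matrix ι ι ℤ)
    {N : ℤ} (hN : N ≠ 0) (hA : A * A = N • A) {a b : ℕ} (hcard : Fintype.card ι = a + b)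
    (htr : A.trace = N * b) : A.charpoly = X ^ a * (X - C N) ^ b := by
  apply Polynomial.map_injective (Int.castRingHom ℂ) Int.cast_injective
  rw [← charpoly_map]
  set B := A.map (Int.castRingHom ℂ) with hB
  have hBB : B * B = (N : ℂ) • B := by
    rw [hB, ← Matrix.map_mul, hA]
    ext i j
    simp [-zsmul_eq_mul]
  have hBtr : B.trace = N * b := by
    rw [hB, ← AddMonoidHom.map_trace, htr]
    simp
  have hsplits := IsAlgClosed.splits B.charpoly
  have hroots : ∀ r ∈ B.charpoly.roots, r ≠ 0 → r = N := by
    intro r hr hr0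
    have hev := Matrix.mem_spectrum_of_isRoot_charpoly (isRoot_of_mem_roots hr)
    rw [← spectrum_toLin', ← Module.End.hasEigenvalue_iff_mem_spectrum] at hev
    obtain ⟨v, hv⟩ := hev.exists_hasEigenvector
    have h1 : B *ᵥ v = r • v := by simpa using hv.apply_eq_smul
    have h2 := congrArg (· *ᵥ v) hBB
    simp only [← mulVec_mulVec, smul_mulVec, h1, mulVec_smul, smul_smul] at h2
    exact mul_right_cancel₀ hr0 (smul_left_injective ℂ hv.2 h2)
  obtain ⟨p, q, hpq⟩ : ∃ p q : ℕ, B.charpoly.roots =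
      Multiset.replicate p 0 + Multiset.replicate q (N : ℂ) := by
    refine ⟨(B.charpoly.roots.filter (· = 0)).card, (B.charpoly.roots.filter (¬ · = 0)).card, ?_⟩
    conv_lhs => rw [← Multiset.filter_add_not (· = 0) B.charpoly.roots]
    congr 1
    · exact Multiset.eq_replicate_card.2 fun r hr => (Multiset.mem_filter.1 hr).2
    · exact Multiset.eq_replicate_card.2 fun r hr =>
        hroots r (Multiset.mem_filter.1 hr).1 (Multiset.mem_filter.1 hr).2
  have hq : q = b := by
    have h := trace_eq_sum_roots_charpoly B
    rw [hBtr, hpq] at h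
    have hN' : (N : ℂ) ≠ 0 := Int.cast_ne_zero.2 hN
    simp only [Multiset.sum_add, Multiset.sum_replicate, smul_zero, zero_add, nsmul_eq_mul,
      mul_comm (q : ℂ)] at h
    exact_mod_cast (mul_left_cancel₀ hN' h).symm
  have hp : p = a := by
    have h := hsplits.natDegree_eq_card_roots
    rw [charpoly_natDegree_eq_dim, hpq, hcard] at h
    simp at h
    omega
  rw [hsplits.eq_prod_roots_of_monic B.charpoly_monic, hpq, hq, hp]
  simp

/-- The combinatorial Laplacian `Bd^k·(Bd^k)ᵀ` of the simplex on `Fin n \ {0}` has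
characteristic polynomial `t^{C(n−2,k−1)} · (t−(n−1))^{C(n−2,k)}`. -/
theorem charpoly_simplex_laplacian
    (n k : ℕ) [NeZero n] (hn : 2 ≤ n) (hk1 : 1 ≤ k) (hk : k ≤ n - 1) :
    (BdMat n k (k + 1) * (BdMat n k (k + 1))ᵀ).charpoly =
      X ^ Nat.choose (n - 2) (k - 1) *
        (X - ((n : ℤ[X]) - 1)) ^ Nat.choose (n - 2) k := by
  have hcard : Fintype.card {s : Finset (Fin n) // s.card = k ∧ (0 : Fin n) ∉ s} =
      (n - 1).choose k := by
    rw [Fintype.card_of_subtype (Finset.powersetCard k (Finset.univ.erase 0))]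
    · simp
    · intro s
      simp only [Finset.mem_powersetCard, Finset.subset_erase, Finset.subset_univ, true_and]
      exact and_comm
  obtain ⟨m, rfl⟩ := Nat.exists_eq_add_of_le' hn
  obtain ⟨j, rfl⟩ := Nat.exists_eq_add_of_le' hk1
  have hN : ((m + 2 : ℕ) : ℤ[X]) - 1 = C ((m : ℤ) + 1) := by
    push_cast [map_add, map_natCast, map_one]
    ring
  rw [hN]
  simp only [Nat.add_sub_cancel, show m + 2 - 1 = m + 1 by omega] at hcard hk ⊢
  refine charpoly_of_mul_self_eq_smul _ (by omega) ?_ ?_ ?_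
  · rw [BdMat_mul_transpose]
    refine (submatrix_val_mul_submatrix_val _ _ ?_).trans ?_
    rotate_left
    · rw [simplicialLaplacian_mul_self, submatrix_smul]
      simp
    · rintro r c ⟨hr, hr0⟩ h
      rw [mul_apply] at h
      obtain ⟨t, -, ht⟩ := Finset.exists_ne_zero_of_sum_ne_zero h
      obtain ⟨h1, h2⟩ := mul_ne_zero_iff.1 ht
      rw [transpose_apply] at h2
      obtain ⟨x, hx, hxr, rfl⟩ := exists_of_boundary_ne_zero h1
      obtain ⟨y, hy, hyc, hxy⟩ := exists_of_boundary_ne_zero h2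
      have hc1 := congrArg Finset.card hxy
      rw [Finset.card_insert_of_notMem hxr, Finset.card_insert_of_notMem hyc] at hc1
      refine ⟨by omega, fun h0 => ?_⟩
      have : (0 : Fin (m + 2)) ∈ insert x r := hxy ▸ Finset.mem_insert_of_mem h0
      have := Finset.ne_of_mem_erase hx
      grind
  · rw [hcard, Nat.choose_succ_succ]
  · rw [BdMat_mul_transpose]
    have h : ∀ r : {s : Finset (Fin (m + 2)) // s.card = j + 1 ∧ (0 : Fin (m + 2)) ∉ s},
        (boundary (Finset.univ.erase (0 : Fin (m + 2))) *
          (boundary (Finset.univ.erase (0 : Fin (m + 2))))ᵀ) r.1 r.1 = ((m - j : ℕ) : ℤ) := by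
      rintro ⟨r, hr, hr0⟩
      rw [simplicialLaplacian_apply_self, Finset.card_sdiff_of_subset, Finset.card_erase_of_mem, hr]
      · simp
      · simp
      · simpa [Finset.subset_erase] using hr0
    simp only [trace, diag, submatrix_apply, h, Finset.sum_const, Finset.card_univ, hcard]
    have := Nat.choose_mul_succ_eq m (j + 1)
    rw [show m + 1 - (j + 1) = m - j by omega] at this
    rw [nsmul_eq_mul, ← Nat.cast_mul, ← this]
    push_cast
    ring
end
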